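/- The minimum of E_α over all assignment maps equals the minimum of M_α over all allocation paths: min{ E_α(S) : S : {1,…,ℓ} → {1,…,k} } = min{ M_α(G) : G ∈ Path[x,b] }. -/

import Mathlib

open scoped BigOperators RealInnerProductSpace

noncomputable section

attribute [local instance] Classical.propDecidable

/-- Points of the ambient Euclidean space `ℝ^m`. -/
abbrev Pt (m : ℕ) := EuclideanSpace ℝ (Fin m)

/-- A weighted directed graph in `ℝ^m`: a finite vertex set, a finite set of
directed edges (ordered pairs of points, viewed as directed line segments), and
a weight function. -/
structure WDG (m : ℕ) where
  V : Finset (Pt m)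
  E : Finset (Pt m × Pt m)
  w : Pt m × Pt m → ℝ

namespace WDG

variable {m : ℕ}

/-- Edges join distinct vertices of the graph and carry positive weight. -/
def edgesOK (G : WDG m) : Prop :=
  ∀ e ∈ G.E, e.1 ∈ G.V ∧ e.2 ∈ G.V ∧ e.1 ≠ e.2 ∧ 0 < G.w e

/-- The underlying undirected (simple) graph. -/
def undirected (G : WDG m) : SimpleGraph (Pt m) :=
  SimpleGraph.fromRel (fun u v => (u, v) ∈ G.E)

/-- The cost `M_α(G) = Σ_{e ∈ E(G)} w(e)^α · length(e)`. -/
def cost (α : ℝ) (G : WDG m) : ℝ :=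
  ∑ e ∈ G.E, (G.w e) ^ α * dist e.1 e.2

/-- Total weight of edges starting at `v`. -/
def outflow (G : WDG m) (v : Pt m) : ℝ :=
  ∑ e ∈ G.E.filter (fun e => e.1 = v), G.w e

/-- Total weight of edges ending at `v`. -/
def inflow (G : WDG m) (v : Pt m) : ℝ :=
  ∑ e ∈ G.E.filter (fun e => e.2 = v), G.w e

end WDG

/-- Atomic measures are represented as finitely supported functions `ℝ^m →₀ ℝ`
with nonnegative values; `AtomicOn X c` also requires the atoms to lie in `X`. -/
def AtomicOn {m : ℕ} (X : Set (Pt m)) (c : Pt m →₀ ℝ) : Prop :=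
  (∀ z, 0 ≤ c z) ∧ ↑c.support ⊆ X

/-- The mass `m(c)` of an atomic measure. -/
def massOf {m : ℕ} (c : Pt m →₀ ℝ) : ℝ := c.sum fun _ t => t

/-- `G` is a transport path from `a` to `b` inside `X`: its vertices lie in `X`
and contain the atoms of `a` and `b`, its underlying undirected graph has no
cycles, and the balance equation holds at every vertex. -/
def IsTransportPath {m : ℕ} (X : Set (Pt m)) (G : WDG m) (a b : Pt m →₀ ℝ) : Prop :=
  G.edgesOK ∧ ↑G.V ⊆ X ∧
  (∀ z ∈ a.support, z ∈ G.V) ∧ (∀ z ∈ b.support, z ∈ G.V) ∧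
  G.undirected.IsAcyclic ∧
  ∀ v : Pt m, G.outflow v - G.inflow v = a v - b v

/-- `d_α(a,b)`: the minimal cost of a transport path from `a` to `b`. -/
def dCost {m : ℕ} (X : Set (Pt m)) (α : ℝ) (a b : Pt m →₀ ℝ) : ℝ :=
  sInf (WDG.cost α '' {G : WDG m | IsTransportPath X G a b})

/-- An optimal transport path from `a` to `b`. -/
def IsOptimalTP {m : ℕ} (X : Set (Pt m)) (α : ℝ) (G : WDG m) (a b : Pt m →₀ ℝ) : Prop :=
  IsTransportPath X G a b ∧
    ∀ G' : WDG m, IsTransportPath X G' a b → WDG.cost α G ≤ WDG.cost α G'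

/-- The atomic probability measure `b = Σ_j n_j δ_{y_j}` of households. -/
def bMeas {m ℓ : ℕ} (y : Fin ℓ → Pt m) (n : Fin ℓ → ℝ) : Pt m →₀ ℝ :=
  ∑ j, Finsupp.single (y j) (n j)

/-- An allocation path from the factory locations `x` to the households `(y,n)`:
a transport path to `b` from some atomic probability measure supported on the
factory locations. -/
def IsAllocPath {m k ℓ : ℕ} (X : Set (Pt m)) (x : Fin k → Pt m)
    (y : Fin ℓ → Pt m) (n : Fin ℓ → ℝ) (G : WDG m) : Prop :=
  ∃ a : Pt m →₀ ℝ, (∀ z, 0 ≤ a z) ∧ ↑a.support ⊆ Set.range x ∧ massOf a = 1 ∧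
    IsTransportPath X G a (bMeas y n)

/-- An optimal allocation path: it minimizes `M_α` over all allocation paths. -/
def IsOptimalAllocPath {m k ℓ : ℕ} (X : Set (Pt m)) (α : ℝ) (x : Fin k → Pt m)
    (y : Fin ℓ → Pt m) (n : Fin ℓ → ℝ) (G : WDG m) : Prop :=
  IsAllocPath X x y n G ∧
    ∀ G' : WDG m, IsAllocPath X x y n G' → WDG.cost α G ≤ WDG.cost α G'

/-- For an assignment map `S`, the part `b_i = Σ_{j : S(j) = i} n_j δ_{y_j}`. -/
def bPart {m k ℓ : ℕ} (y : Fin ℓ → Pt m) (n : Fin ℓ → ℝ) (S : Fin ℓ → Fin k)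
    (i : Fin k) : Pt m →₀ ℝ :=
  ∑ j ∈ Finset.univ.filter (fun j => S j = i), Finsupp.single (y j) (n j)

/-- The mass `m(b_i) = Σ_{j : S(j) = i} n_j`. -/
def mB {k ℓ : ℕ} (n : Fin ℓ → ℝ) (S : Fin ℓ → Fin k) (i : Fin k) : ℝ :=
  ∑ j ∈ Finset.univ.filter (fun j => S j = i), n j

/-- `E_α(S) = Σ_i d_α(m(b_i) δ_{x_i}, b_i)`. -/
def Ealpha {m k ℓ : ℕ} (X : Set (Pt m)) (α : ℝ) (x : Fin k → Pt m)
    (y : Fin ℓ → Pt m) (n : Fin ℓ → ℝ) (S : Fin ℓ → Fin k) : ℝ :=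
  ∑ i, dCost X α (Finsupp.single (x i) (mB n S i)) (bPart y n S i)

/-- An optimal assignment map minimizes `E_α` over all assignment maps. -/
def IsOptimalAssign {m k ℓ : ℕ} (X : Set (Pt m)) (α : ℝ) (x : Fin k → Pt m)
    (y : Fin ℓ → Pt m) (n : Fin ℓ → ℝ) (S : Fin ℓ → Fin k) : Prop :=
  ∀ S' : Fin ℓ → Fin k, Ealpha X α x y n S ≤ Ealpha X α x y n S'

/-- `ρ_α(σ,ε)`: equals `(σ/ε)^α − (σ/ε − 1)^α` for `σ > ε` (and for `σ = ε` when
`α ∈ (0,1)`), and equals `1` when `σ = ε` (covering also the convention for `α = 0`). -/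
def rho (α σ ε : ℝ) : ℝ :=
  if σ = ε then 1 else (σ / ε) ^ α - (σ / ε - 1) ^ α


/-- `G` is the disjoint union of the subgraphs `Gi`: the `Gi` have pairwise
disjoint vertex sets, each is a subgraph of `G` (with matching weights), and
the edges of `G` are exactly the (disjoint) union of their edges. -/
def IsDisjointUnion {m k : ℕ} (G : WDG m) (Gi : Fin k → WDG m) : Prop :=
  (∀ i i' : Fin k, i ≠ i' → Disjoint (Gi i).V (Gi i').V) ∧
  (∀ i, (Gi i).V ⊆ G.V) ∧
  (∀ i, (Gi i).E ⊆ G.E) ∧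
  (∀ i, ∀ e ∈ (Gi i).E, (Gi i).w e = G.w e) ∧
  G.E = Finset.univ.biUnion (fun i => (Gi i).E)

/-- The projection coordinate `π(z) = ⟨z − p, v⟩` along the line through `p`
in direction `v`. -/
def proj {m : ℕ} (p v z : Pt m) : ℝ := ⟪z - p, v⟫

/-- The constant `C = √(m−1)/(2^{1−(m−1)(1−α)} − 1) + 1`. -/
def Cconst (m : ℕ) (α : ℝ) : ℝ :=
  Real.sqrt ((m : ℝ) - 1) / ((2 : ℝ) ^ (1 - ((m : ℝ) - 1) * (1 - α)) - 1) + 1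


/-! ### Concave costs of nonnegative combinations -/

/-- The concave cost `∑ u(e)^α L(e)` over the support of `u`. -/
def flowCost {ι : Type*} (α : ℝ) (L : ι → ℝ) (u : ι →₀ ℝ) : ℝ :=
  u.sum fun e t => t ^ α * L e

/-- `u` is basic for `D` if no nonzero vector supported in the support of `u` is killed by `D`. -/
def IsBasic {ι M : Type*} [AddCommGroup M] [Module ℝ M] (D : (ι →₀ ℝ) →ₗ[ℝ] M)
    (u : ι →₀ ℝ) : Prop :=
  ∀ z : ι →₀ ℝ, z.support ⊆ u.support → D z = 0 → z = 0

section Cost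

variable {ι κ : Type*} {α : ℝ}

lemma flowCost_eq_sum (L : ι → ℝ) (u : ι →₀ ℝ) (s : Finset ι) (hs : u.support ⊆ s) :
    flowCost α L u = ∑ e ∈ s, (if u e = 0 then 0 else u e ^ α) * L e := by
  unfold flowCost Finsupp.sum
  rw [← Finset.sum_subset hs]
  · refine Finset.sum_congr rfl fun e he => ?_
    rw [if_neg (Finsupp.mem_support_iff.mp he)]
  · intro e _ he
    rw [if_pos (Finsupp.notMem_support_iff.mp he), zero_mul]

lemma flowCost_zero (L : ι → ℝ) : flowCost α L (0 : ι →₀ ℝ) = 0 := by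
  simp [flowCost]

lemma flowCost_single_le {L : ι → ℝ} (hL : ∀ e, 0 ≤ L e) (e : ι) {t : ℝ} (ht : 0 ≤ t) :
    flowCost α L (Finsupp.single e t) ≤ t ^ α * L e := by
  rw [flowCost_eq_sum L _ {e} Finsupp.support_single_subset]
  simp only [Finset.sum_singleton, Finsupp.single_eq_same]
  split_ifs
  · rw [zero_mul]
    exact mul_nonneg (Real.rpow_nonneg ht _) (hL e)
  · exact le_rfl

lemma rpow_add_le_of_le_one (hα0 : 0 ≤ α) (hα1 : α ≤ 1) {s t : ℝ} (hs : 0 ≤ s) (ht : 0 ≤ t) :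
    (s + t) ^ α ≤ s ^ α + t ^ α := by
  lift s to NNReal using hs
  lift t to NNReal using ht
  exact_mod_cast NNReal.rpow_add_le_add_rpow s t hα0 hα1

lemma flowCost_add_le (hα0 : 0 ≤ α) (hα1 : α ≤ 1) {L : ι → ℝ} (hL : ∀ e, 0 ≤ L e)
    {u v : ι →₀ ℝ} (hu : ∀ e, 0 ≤ u e) (hv : ∀ e, 0 ≤ v e) :
    flowCost α L (u + v) ≤ flowCost α L u + flowCost α L v := by
  rw [flowCost_eq_sum L (u + v) (u.support ∪ v.support) Finsupp.support_add,
    flowCost_eq_sum L u (u.support ∪ v.support) Finset.subset_union_left,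
    flowCost_eq_sum L v (u.support ∪ v.support) Finset.subset_union_right,
    ← Finset.sum_add_distrib]
  refine Finset.sum_le_sum fun e _ => ?_
  rw [← add_mul]
  refine mul_le_mul_of_nonneg_right ?_ (hL e)
  have h1 := hu e
  have h2 := hv e
  rw [Finsupp.add_apply]
  by_cases hu0 : u e = 0
  · simp [hu0]
  by_cases hv0 : v e = 0
  · simp [hv0]
  have : u e + v e ≠ 0 := by positivity
  rw [if_neg this, if_neg hu0, if_neg hv0]
  exact rpow_add_le_of_le_one hα0 hα1 h1 h2

lemma flowCost_sum_le (hα0 : 0 ≤ α) (hα1 : α ≤ 1) {L : ι → ℝ} (hL : ∀ e, 0 ≤ L e)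
    (s : Finset κ) (v : κ → ι →₀ ℝ) (hv : ∀ i ∈ s, ∀ e, 0 ≤ v i e) :
    flowCost α L (∑ i ∈ s, v i) ≤ ∑ i ∈ s, flowCost α L (v i) := by
  induction s using Finset.induction_on with
  | empty => simp [flowCost_zero]
  | insert a s ha ih =>
    rw [Finset.sum_insert ha, Finset.sum_insert ha]
    have hs : ∀ i ∈ s, ∀ e, 0 ≤ v i e := fun i hi => hv i (Finset.mem_insert_of_mem hi)
    refine (flowCost_add_le hα0 hα1 hL (hv a (Finset.mem_insert_self a s)) ?_).trans
      (add_le_add_right (ih hs) _)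
    intro e
    rw [Finsupp.finsetSum_apply]
    exact Finset.sum_nonneg fun i hi => hs i hi e

lemma mapDomain_nonneg_of_nonneg (f : ι → κ) {u : ι →₀ ℝ} (hu : ∀ e, 0 ≤ u e) (e : κ) :
    0 ≤ Finsupp.mapDomain f u e := by
  rw [Finsupp.mapDomain, Finsupp.sum, Finsupp.finsetSum_apply]
  refine Finset.sum_nonneg fun i _ => ?_
  rw [Finsupp.single_apply]
  split_ifs
  · exact hu i
  · exact le_rfl

lemma flowCost_mapDomain_le (hα0 : 0 ≤ α) (hα1 : α ≤ 1) (f : ι → κ) {L : κ → ℝ}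
    (hL : ∀ e, 0 ≤ L e) {u : ι →₀ ℝ} (hu : ∀ e, 0 ≤ u e) :
    flowCost α L (Finsupp.mapDomain f u) ≤ flowCost α (L ∘ f) u := by
  rw [Finsupp.mapDomain, Finsupp.sum]
  refine (flowCost_sum_le hα0 hα1 hL _ _ fun i _ e => ?_).trans ?_
  · rw [Finsupp.single_apply]
    split_ifs
    · exact hu i
    · exact le_rfl
  · rw [flowCost, Finsupp.sum]
    exact Finset.sum_le_sum fun i _ => flowCost_single_le hL _ (hu i)

lemma flowCost_congr {L L' : ι → ℝ} {u : ι →₀ ℝ} (h : ∀ e ∈ u.support, L e = L' e) :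
    flowCost α L u = flowCost α L' u :=
  Finset.sum_congr rfl fun e he => by simp only [h e he]

lemma rpow_le_tangent (hα0 : 0 ≤ α) (hα1 : α ≤ 1) {s t : ℝ} (hs : 0 < s) (ht : 0 ≤ t) :
    t ^ α ≤ s ^ α + α * s ^ (α - 1) * (t - s) := by
  have h := rpow_one_add_le_one_add_mul_self (s := t / s - 1)
    (by linarith [div_nonneg ht hs.le]) hα0 hα1
  have h1 : 1 + (t / s - 1) = t / s := by ring
  rw [h1, Real.div_rpow ht hs.le, div_le_iff₀ (Real.rpow_pos_of_pos hs α)] at h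
  refine h.trans (le_of_eq ?_)
  rw [Real.rpow_sub_one hs.ne']
  field_simp

/-- Moving in a direction of nonpositive first variation until a coordinate vanishes does not
increase the cost. -/
lemma exists_smaller_support_of_direction (hα0 : 0 ≤ α) (hα1 : α ≤ 1) {L : ι → ℝ}
    (hL : ∀ e, 0 ≤ L e) {u z : ι →₀ ℝ} (hu : ∀ e, 0 ≤ u e) (hz : z.support ⊆ u.support)
    (hneg : ∃ e, z e < 0)
    (hD : ∑ e ∈ u.support, α * u e ^ (α - 1) * z e * L e ≤ 0) :
    ∃ t : ℝ, (∀ e, 0 ≤ (u + t • z) e) ∧ (u + t • z).support ⊂ u.support ∧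
      flowCost α L (u + t • z) ≤ flowCost α L u := by
  have hpos : ∀ e ∈ u.support, 0 < u e := fun e he =>
    lt_of_le_of_ne (hu e) (Ne.symm (Finsupp.mem_support_iff.mp he))
  obtain ⟨e₀, he₀⟩ := hneg
  have hmem : ∀ e, z e ≠ 0 → e ∈ u.support := fun e he => hz (Finsupp.mem_support_iff.mpr he)
  obtain ⟨e₁, he₁, hmin⟩ := Finset.exists_min_image (u.support.filter fun e => z e < 0)
    (fun e => u e / (-z e)) ⟨e₀, Finset.mem_filter.mpr ⟨hmem e₀ he₀.ne, he₀⟩⟩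
  obtain ⟨he₁s, he₁n⟩ := Finset.mem_filter.mp he₁
  set t := u e₁ / (-z e₁) with ht
  have htpos : 0 < t := div_pos (hpos e₁ he₁s) (by linarith)
  have hnn : ∀ e, 0 ≤ (u + t • z) e := by
    intro e
    simp only [Finsupp.add_apply, Finsupp.smul_apply, smul_eq_mul]
    by_cases hze : z e < 0
    · have := hmin e (Finset.mem_filter.mpr ⟨hmem e hze.ne, hze⟩)
      rw [le_div_iff₀ (by linarith)] at this
      linarith
    · have := mul_nonneg htpos.le (not_lt.mp hze)
      linarith [hu e]
  have hsub : (u + t • z).support ⊆ u.support :=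
    Finsupp.support_add.trans
      (Finset.union_subset subset_rfl (Finsupp.support_smul.trans hz))
  refine ⟨t, hnn, (Finset.ssubset_iff_of_subset hsub).mpr ⟨e₁, he₁s, ?_⟩, ?_⟩
  · rw [Finsupp.notMem_support_iff]
    simp only [Finsupp.add_apply, Finsupp.smul_apply, smul_eq_mul, ht]
    have := he₁n.ne
    field_simp
    ring
  · rw [flowCost_eq_sum L _ _ hsub, flowCost, Finsupp.sum]
    have key : ∀ e ∈ u.support, (if (u + t • z) e = 0 then 0 else (u + t • z) e ^ α) * L e ≤
        u e ^ α * L e + t * (α * u e ^ (α - 1) * z e * L e) := by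
      intro e he
      have h1 := rpow_le_tangent hα0 hα1 (hpos e he) (hnn e)
      have h2 : (if (u + t • z) e = 0 then 0 else (u + t • z) e ^ α) ≤ (u + t • z) e ^ α := by
        split_ifs
        · exact Real.rpow_nonneg (hnn e) _
        · exact le_rfl
      refine (mul_le_mul_of_nonneg_right (h2.trans h1) (hL e)).trans (le_of_eq ?_)
      simp only [Finsupp.add_apply, Finsupp.smul_apply, smul_eq_mul]
      ring
    refine (Finset.sum_le_sum key).trans ?_
    rw [Finset.sum_add_distrib, ← Finset.mul_sum]
    linarith [mul_nonpos_of_nonneg_of_nonpos htpos.le hD]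

/-- Every nonnegative vector is dominated by a basic one with the same image under `D`. -/
lemma exists_isBasic {M : Type*} [AddCommGroup M] [Module ℝ M] (hα0 : 0 ≤ α) (hα1 : α ≤ 1)
    {L : ι → ℝ} (hL : ∀ e, 0 ≤ L e) (D : (ι →₀ ℝ) →ₗ[ℝ] M) (u : ι →₀ ℝ)
    (hu : ∀ e, 0 ≤ u e) :
    ∃ v : ι →₀ ℝ, (∀ e, 0 ≤ v e) ∧ v.support ⊆ u.support ∧ D v = D u ∧
      flowCost α L v ≤ flowCost α L u ∧ IsBasic D v := by
  induction hc : u.support.card using Nat.strong_induction_on generalizing u with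
  | _ N ih =>
  by_cases hb : IsBasic D u
  · exact ⟨u, hu, subset_rfl, rfl, le_rfl, hb⟩
  unfold IsBasic at hb
  push Not at hb
  obtain ⟨z, hzs, hDz, hz0⟩ := hb
  have hdir : ∃ z' : ι →₀ ℝ, z'.support ⊆ u.support ∧ D z' = 0 ∧ (∃ e, z' e < 0) ∧
      ∑ e ∈ u.support, α * u e ^ (α - 1) * z' e * L e ≤ 0 := by
    by_cases hn : (∃ e, z e < 0) ∧ ∑ e ∈ u.support, α * u e ^ (α - 1) * z e * L e ≤ 0
    · exact ⟨z, hzs, hDz, hn.1, hn.2⟩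
    have hcoef : ∀ e, 0 ≤ α * u e ^ (α - 1) := fun e =>
      mul_nonneg hα0 (Real.rpow_nonneg (hu e) _)
    have hnegsum : ∑ e ∈ u.support, α * u e ^ (α - 1) * (-z) e * L e =
        -∑ e ∈ u.support, α * u e ^ (α - 1) * z e * L e := by
      rw [← Finset.sum_neg_distrib]
      refine Finset.sum_congr rfl fun e _ => ?_
      rw [Finsupp.neg_apply]
      ring
    refine ⟨-z, by rwa [Finsupp.support_neg], by rw [map_neg, hDz, neg_zero], ?_, ?_⟩
    · by_contra hcon
      push Not at hcon
      have hzle : ∀ e, z e ≤ 0 := fun e => by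
        have := hcon e
        rw [Finsupp.neg_apply] at this
        linarith
      obtain ⟨e, he⟩ := Finsupp.ne_iff.mp hz0
      refine hn ⟨⟨e, lt_of_le_of_ne (hzle e) he⟩, Finset.sum_nonpos fun e _ => ?_⟩
      exact mul_nonpos_of_nonpos_of_nonneg
        (mul_nonpos_of_nonneg_of_nonpos (hcoef e) (hzle e)) (hL e)
    · rw [hnegsum, neg_nonpos]
      by_cases hn1 : ∃ e, z e < 0
      · by_contra hlt
        exact hn ⟨hn1, (not_le.mp hlt).le⟩
      · push Not at hn1
        exact Finset.sum_nonneg fun e _ => mul_nonneg (mul_nonneg (hcoef e) (hn1 e)) (hL e)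
  obtain ⟨z', hz's, hDz', hneg, hsum⟩ := hdir
  obtain ⟨t, hnn, hss, hcost⟩ :=
    exists_smaller_support_of_direction hα0 hα1 hL hu hz's hneg hsum
  obtain ⟨v, hv, hvs, hvD, hvc, hvb⟩ :=
    ih _ (hc ▸ Finset.card_lt_card hss) (u + t • z') hnn rfl
  exact ⟨v, hv, hvs.trans hss.subset, by rw [hvD, map_add, map_smul, hDz', smul_zero, add_zero],
    hvc.trans hcost, hvb⟩

end Cost

/-! ### Flows with a free supply at the factories -/

section Flow

variable {J K : Type*} {k : ℕ}

/-- The boundary of an edge: `inl (p, q)` is an edge from `p` to `q`, and `inr i` is a supply edge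
into the factory `x i`. -/
def edgeBdry (x : Fin k → J) : (J × J) ⊕ Fin k → (J →₀ ℝ)
  | Sum.inl e => Finsupp.single e.1 1 - Finsupp.single e.2 1
  | Sum.inr i => -Finsupp.single (x i) 1

/-- The boundary of a weighted family of edges. -/
def bdry (x : Fin k → J) : ((J × J) ⊕ Fin k →₀ ℝ) →ₗ[ℝ] (J →₀ ℝ) :=
  Finsupp.linearCombination ℝ (edgeBdry x)

/-- The action of a map of vertices on edges. -/
def edgeMap (φ : J → K) : (J × J) ⊕ Fin k → (K × K) ⊕ Fin k :=
  Sum.map (Prod.map φ φ) id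

/-- The length of an edge when the vertices are placed by `p`; supply edges are free. -/
def edgeLen {m : ℕ} (p : J → Pt m) : (J × J) ⊕ Fin k → ℝ
  | Sum.inl e => dist (p e.1) (p e.2)
  | Sum.inr _ => 0

lemma edgeLen_nonneg {m : ℕ} (p : J → Pt m) (e : (J × J) ⊕ Fin k) : 0 ≤ edgeLen p e := by
  rcases e with e | i
  · exact dist_nonneg
  · exact le_rfl

lemma edgeLen_comp_edgeMap {m : ℕ} (p : K → Pt m) (φ : J → K) :
    (edgeLen p : (K × K) ⊕ Fin k → ℝ) ∘ edgeMap φ = edgeLen (p ∘ φ) := by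
  funext e
  rcases e with e | i <;> rfl

lemma bdry_single_inl (x : Fin k → J) (e : J × J) (t : ℝ) :
    bdry x (Finsupp.single (Sum.inl e) t) = Finsupp.single e.1 t - Finsupp.single e.2 t := by
  simp [bdry, edgeBdry, smul_sub]

lemma bdry_single_inr (x : Fin k → J) (i : Fin k) (t : ℝ) :
    bdry x (Finsupp.single (Sum.inr i) t) = -Finsupp.single (x i) t := by
  simp [bdry, edgeBdry]

lemma bdry_mapDomain (x : Fin k → J) (φ : J → K) (u : (J × J) ⊕ Fin k →₀ ℝ) :
    bdry (φ ∘ x) (Finsupp.mapDomain (edgeMap φ) u) = Finsupp.mapDomain φ (bdry x u) := by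
  induction u using Finsupp.induction_linear with
  | zero => simp
  | add u v hu hv => simp only [Finsupp.mapDomain_add, map_add, hu, hv]
  | single e t =>
    rw [Finsupp.mapDomain_single]
    rcases e with e | i
    · simp only [edgeMap, Sum.map_inl, bdry_single_inl, Prod.map_fst, Prod.map_snd, sub_eq_add_neg,
        Finsupp.mapDomain_add, ← Finsupp.single_neg, Finsupp.mapDomain_single]
    · simp only [edgeMap, Sum.map_inr, bdry_single_inr, id_eq, Function.comp_apply,
        ← Finsupp.single_neg, Finsupp.mapDomain_single]

lemma linearCombination_bdry (x : Fin k → J) (f : J → ℝ) (u : (J × J) ⊕ Fin k →₀ ℝ) :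
    Finsupp.linearCombination ℝ f (bdry x u) =
      ∑ e ∈ u.support.toLeft, u (Sum.inl e) * (f e.1 - f e.2) -
        ∑ i, u (Sum.inr i) * f (x i) := by
  have h1 : ∑ i, u (Sum.inr i) * f (x i) =
      ∑ i ∈ u.support.toRight, u (Sum.inr i) * f (x i) := by
    symm
    refine Finset.sum_subset (Finset.subset_univ _) fun i _ hi => ?_
    rw [Finset.mem_toRight, Finsupp.notMem_support_iff] at hi
    rw [hi, zero_mul]
  rw [h1, bdry, Finsupp.apply_linearCombination, Finsupp.linearCombination_apply, Finsupp.sum,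
    ← Finset.toLeft_disjSum_toRight (u := u.support), Finset.sum_disjSum,
    Finset.toLeft_disjSum_toRight, sub_eq_add_neg, ← Finset.sum_neg_distrib]
  congr 1
  · refine Finset.sum_congr rfl fun e _ => ?_
    simp [edgeBdry]
  · refine Finset.sum_congr rfl fun i _ => ?_
    simp [edgeBdry]

lemma linearCombination_indicator [DecidableEq J] (c : J →₀ ℝ) (v : J) :
    Finsupp.linearCombination ℝ (fun z => if z = v then (1 : ℝ) else 0) c = c v := by
  rw [Finsupp.linearCombination_apply, Finsupp.sum]
  simp only [smul_eq_mul, mul_ite, mul_one, mul_zero, Finset.sum_ite_eq']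
  split_ifs with h
  · rfl
  · exact (Finsupp.notMem_support_iff.mp h).symm

lemma bdry_apply [DecidableEq J] (x : Fin k → J) (u : (J × J) ⊕ Fin k →₀ ℝ) (v : J) :
    bdry x u v = ∑ e ∈ u.support.toLeft with e.1 = v, u (Sum.inl e) -
      ∑ e ∈ u.support.toLeft with e.2 = v, u (Sum.inl e) -
        ∑ i with x i = v, u (Sum.inr i) := by
  rw [← linearCombination_indicator, linearCombination_bdry, Finset.sum_filter, Finset.sum_filter,
    Finset.sum_filter, ← Finset.sum_sub_distrib]
  congr 1
  · refine Finset.sum_congr rfl fun e _ => ?_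
    split_ifs <;> ring
  · refine Finset.sum_congr rfl fun e _ => ?_
    split_ifs <;> ring

/-- Connectedness through edges of `s` gives a chain supported in `s` joining the two points. -/
lemma exists_chain_of_reachable (x : Fin k → J) {H : SimpleGraph J} {s : Set (J × J)}
    (hs : ∀ p q, H.Adj p q → (p, q) ∈ s ∨ (q, p) ∈ s) {p q : J} (h : H.Reachable p q) :
    ∃ z : (J × J) ⊕ Fin k →₀ ℝ, (∀ e ∈ z.support, ∃ d ∈ s, e = Sum.inl d) ∧
      bdry x z = Finsupp.single p 1 - Finsupp.single q 1 := by
  obtain ⟨w⟩ := h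
  induction w with
  | nil => exact ⟨0, by simp, by simp⟩
  | @cons a b c hab _ ih =>
    obtain ⟨z, hz, hzb⟩ := ih
    obtain ⟨d, t, hd, hdb⟩ : ∃ (d : J × J) (t : ℝ), d ∈ s ∧
        bdry x (Finsupp.single (Sum.inl d) t) = Finsupp.single a 1 - Finsupp.single b 1 := by
      rcases hs a b hab with h | h
      · exact ⟨_, 1, h, bdry_single_inl x _ _⟩
      · refine ⟨_, -1, h, ?_⟩
        rw [bdry_single_inl, Finsupp.single_neg, Finsupp.single_neg]
        abel
    refine ⟨z + Finsupp.single (Sum.inl d) t, fun e he => ?_, ?_⟩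
    · rcases Finset.mem_union.mp (Finsupp.support_add he) with he | he
      · exact hz e he
      · exact ⟨d, hd, Finset.mem_singleton.mp (Finsupp.support_single_subset he)⟩
    · rw [map_add, hzb, hdb]
      abel

lemma IsBasic.ne {x : Fin k → J} {u : (J × J) ⊕ Fin k →₀ ℝ} (hb : IsBasic (bdry x) u) {p q : J}
    (h : Sum.inl (p, q) ∈ u.support) : p ≠ q := by
  rintro rfl
  have h0 := hb (Finsupp.single (Sum.inl (p, p)) 1)
    (Finsupp.support_single_subset.trans (Finset.singleton_subset_iff.mpr h))
    (by rw [bdry_single_inl, sub_self])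
  exact one_ne_zero (Finsupp.single_eq_zero.mp h0)

/-- The underlying undirected graph of a basic flow is acyclic. -/
lemma IsBasic.isAcyclic {x : Fin k → J} {u : (J × J) ⊕ Fin k →₀ ℝ} (hb : IsBasic (bdry x) u)
    {E : Finset (J × J)} (hE : ∀ e ∈ E, Sum.inl e ∈ u.support) :
    (SimpleGraph.fromRel fun p q => (p, q) ∈ E).IsAcyclic := by
  rw [SimpleGraph.isAcyclic_iff_forall_adj_isBridge]
  have key : ∀ p q, (p, q) ∈ E →
      (SimpleGraph.fromRel fun p q => (p, q) ∈ E).IsBridge s(p, q) := by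
    intro p q hpq
    rw [SimpleGraph.isBridge_iff]
    intro hr
    obtain ⟨z, hz, hzb⟩ := exists_chain_of_reachable x (s := {d | d ∈ E ∧ d ≠ (p, q)}) (by
      intro a b hab
      rw [SimpleGraph.deleteEdges_adj, SimpleGraph.fromRel_adj] at hab
      obtain ⟨⟨_, hab | hab⟩, hne⟩ := hab
      · refine Or.inl ⟨hab, fun h => hne ?_⟩
        obtain ⟨rfl, rfl⟩ := Prod.mk.inj h
        exact rfl
      · refine Or.inr ⟨hab, fun h => hne ?_⟩
        obtain ⟨rfl, rfl⟩ := Prod.mk.inj h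
        exact Sym2.eq_swap) hr
    have h0 := hb (z - Finsupp.single (Sum.inl (p, q)) 1) (by
      intro e he
      rcases Finset.mem_union.mp (Finsupp.support_sub he) with he | he
      · obtain ⟨d, hd, rfl⟩ := hz e he
        exact hE d hd.1
      · rw [Finset.mem_singleton.mp (Finsupp.support_single_subset he)]
        exact hE _ hpq) (by rw [map_sub, hzb, bdry_single_inl, sub_self])
    have h1 : z (Sum.inl (p, q)) = 0 := by
      by_contra hne
      obtain ⟨d, hd, hde⟩ := hz _ (Finsupp.mem_support_iff.mpr hne)
      exact hd.2 (Sum.inl_injective hde).symm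
    have h2 := DFunLike.congr_fun h0 (Sum.inl (p, q))
    rw [Finsupp.sub_apply, h1, Finsupp.single_eq_same] at h2
    norm_num at h2
  intro p q hpq
  rw [SimpleGraph.fromRel_adj] at hpq
  rcases hpq.2 with h | h
  · exact key p q h
  · rw [Sym2.eq_swap]
    exact key q p h

/-- Two factories of a basic flow with positive supply are not connected. -/
lemma IsBasic.eq_of_reachable {x : Fin k → J} {u : (J × J) ⊕ Fin k →₀ ℝ}
    (hb : IsBasic (bdry x) u) {E : Finset (J × J)} (hE : ∀ e ∈ E, Sum.inl e ∈ u.support)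
    {i i' : Fin k} (hi : Sum.inr i ∈ u.support) (hi' : Sum.inr i' ∈ u.support)
    (h : (SimpleGraph.fromRel fun p q => (p, q) ∈ E).Reachable (x i) (x i')) : i = i' := by
  by_contra hne
  obtain ⟨z, hz, hzb⟩ := exists_chain_of_reachable x (s := {d | d ∈ E})
    (fun a b hab => (SimpleGraph.fromRel_adj _ _ _ |>.mp hab).2) h
  have h0 := hb (z + (Finsupp.single (Sum.inr i) 1 - Finsupp.single (Sum.inr i') 1)) (by
    intro e he
    rcases Finset.mem_union.mp (Finsupp.support_add he) with he | he
    · obtain ⟨d, hd, rfl⟩ := hz e he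
      exact hE d hd
    · rcases Finset.mem_union.mp (Finsupp.support_sub he) with he | he
      · rwa [Finset.mem_singleton.mp (Finsupp.support_single_subset he)]
      · rwa [Finset.mem_singleton.mp (Finsupp.support_single_subset he)])
    (by rw [map_add, map_sub, hzb, bdry_single_inr, bdry_single_inr]; abel)
  have h1 : z (Sum.inr i) = 0 := by
    by_contra hne
    obtain ⟨d, _, hde⟩ := hz _ (Finsupp.mem_support_iff.mpr hne)
    exact Sum.inr_ne_inl hde
  have h2 := DFunLike.congr_fun h0 (Sum.inr i)
  rw [Finsupp.add_apply, Finsupp.sub_apply, h1, Finsupp.single_eq_same,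
    Finsupp.single_eq_of_ne (by simpa using hne)] at h2
  norm_num at h2

end Flow

/-! ### From flows to graphs and back -/

section Graphs

variable {m k ℓ : ℕ} {α : ℝ}

/-- A nonnegative flow in `X` from freely supplied factories `x` to `b`. -/
structure IsFlow (X : Set (Pt m)) (x : Fin k → Pt m) (b : Pt m →₀ ℝ)
    (u : (Pt m × Pt m) ⊕ Fin k →₀ ℝ) : Prop where
  nonneg : ∀ e, 0 ≤ u e
  mem : ∀ p q, Sum.inl (p, q) ∈ u.support → p ∈ X ∧ q ∈ X
  bdry_eq : bdry x u = -b

lemma IsFlow.exists_isBasic {X : Set (Pt m)} {x : Fin k → Pt m} {b : Pt m →₀ ℝ}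
    {u : (Pt m × Pt m) ⊕ Fin k →₀ ℝ} (hu : IsFlow X x b u) (hα0 : 0 ≤ α) (hα1 : α ≤ 1) :
    ∃ v, IsFlow X x b v ∧ v.support ⊆ u.support ∧
      flowCost α (edgeLen id) v ≤ flowCost α (edgeLen id) u ∧ IsBasic (bdry x) v := by
  obtain ⟨v, hv, hvs, hvD, hvc, hvb⟩ :=
    _root_.exists_isBasic hα0 hα1 (edgeLen_nonneg id) (bdry x) u hu.nonneg
  exact ⟨v, ⟨hv, fun p q h => hu.mem p q (hvs h), hvD.trans hu.bdry_eq⟩, hvs, hvc, hvb⟩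

lemma flowCost_edgeLen {J : Type*} (p : J → Pt m) (u : (J × J) ⊕ Fin k →₀ ℝ) :
    flowCost α (edgeLen p) u =
      ∑ e ∈ u.support.toLeft, u (Sum.inl e) ^ α * dist (p e.1) (p e.2) := by
  rw [flowCost, Finsupp.sum, ← Finset.toLeft_disjSum_toRight (u := u.support),
    Finset.sum_disjSum, Finset.toLeft_disjSum_toRight]
  simp [edgeLen]

lemma IsFlow.sum_supply {X : Set (Pt m)} {x : Fin k → Pt m} {b : Pt m →₀ ℝ}
    {u : (Pt m × Pt m) ⊕ Fin k →₀ ℝ} (hu : IsFlow X x b u) :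
    ∑ i, u (Sum.inr i) = massOf b := by
  have h := linearCombination_bdry x (fun _ => (1 : ℝ)) u
  rw [hu.bdry_eq, map_neg, Finsupp.linearCombination_apply] at h
  simp only [sub_self, mul_zero, Finset.sum_const_zero, mul_one, smul_eq_mul, zero_sub,
    neg_inj] at h
  exact h.symm

/-- The part in `C` of the graph carried by a flow, with additional vertices `V₀`. -/
def flowGraph (V₀ : Finset (Pt m)) (C : Set (Pt m)) (u : (Pt m × Pt m) ⊕ Fin k →₀ ℝ) :
    WDG m where
  V := V₀ ∪ ((u.support.toLeft.filter fun e => e.1 ∈ C).image Prod.fst ∪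
    (u.support.toLeft.filter fun e => e.1 ∈ C).image Prod.snd)
  E := u.support.toLeft.filter fun e => e.1 ∈ C
  w e := u (Sum.inl e)

lemma isTransportPath_flowGraph {X : Set (Pt m)} {x : Fin k → Pt m} {b : Pt m →₀ ℝ}
    {u : (Pt m × Pt m) ⊕ Fin k →₀ ℝ} (hu : IsFlow X x b u) (hb : IsBasic (bdry x) u)
    (C : Set (Pt m)) (hC : ∀ p q, Sum.inl (p, q) ∈ u.support → (p ∈ C ↔ q ∈ C))
    {a c : Pt m →₀ ℝ} (haX : ↑a.support ⊆ X) (hcX : ↑c.support ⊆ X)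
    (ha : ∀ z ∈ C, a z = ∑ i with x i = z, u (Sum.inr i)) (ha0 : ∀ z ∉ C, a z = 0)
    (hc : ∀ z ∈ C, c z = b z) (hc0 : ∀ z ∉ C, c z = 0) :
    IsTransportPath X (flowGraph (a.support ∪ c.support) C u) a c := by
  have hE : ∀ e ∈ (flowGraph (a.support ∪ c.support) C u).E, Sum.inl e ∈ u.support := fun e he =>
    Finset.mem_toLeft.mp (Finset.mem_filter.mp he).1
  refine ⟨?_, ?_, ?_, ?_, hb.isAcyclic hE, ?_⟩
  · rintro ⟨p, q⟩ he
    have hs := hE _ he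
    refine ⟨?_, ?_, hb.ne hs,
      lt_of_le_of_ne (hu.nonneg _) (Ne.symm (Finsupp.mem_support_iff.mp hs))⟩
    · exact Finset.mem_union_right _ (Finset.mem_union_left _
        (Finset.mem_image.mpr ⟨_, he, rfl⟩))
    · exact Finset.mem_union_right _ (Finset.mem_union_right _
        (Finset.mem_image.mpr ⟨_, he, rfl⟩))
  · intro z hz
    rcases Finset.mem_union.mp hz with hz | hz
    · rcases Finset.mem_union.mp hz with hz | hz
      · exact haX hz
      · exact hcX hz
    · rcases Finset.mem_union.mp hz with hz | hz
      · obtain ⟨⟨p, q⟩, he, rfl⟩ := Finset.mem_image.mp hz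
        exact (hu.mem p q (hE _ he)).1
      · obtain ⟨⟨p, q⟩, he, rfl⟩ := Finset.mem_image.mp hz
        exact (hu.mem p q (hE _ he)).2
  · exact fun z hz => Finset.mem_union_left _ (Finset.mem_union_left _ hz)
  · exact fun z hz => Finset.mem_union_left _ (Finset.mem_union_right _ hz)
  · intro v
    simp only [WDG.outflow, WDG.inflow, flowGraph, Finset.filter_filter]
    by_cases hv : v ∈ C
    · have h := bdry_apply x u v
      rw [hu.bdry_eq, Finsupp.neg_apply] at h
      rw [ha v hv, hc v hv]
      have h1 : (u.support.toLeft.filter fun e => e.1 ∈ C ∧ e.1 = v) =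
          u.support.toLeft.filter fun e => e.1 = v := by
        refine Finset.filter_congr fun e _ => ⟨fun h => h.2, fun h => ⟨h ▸ hv, h⟩⟩
      have h2 : (u.support.toLeft.filter fun e => e.1 ∈ C ∧ e.2 = v) =
          u.support.toLeft.filter fun e => e.2 = v := by
        refine Finset.filter_congr fun e he => ⟨fun h => h.2, fun h => ⟨?_, h⟩⟩
        exact (hC e.1 e.2 (Finset.mem_toLeft.mp he)).mpr (h ▸ hv)
      rw [h1, h2]
      linarith
    · rw [ha0 v hv, hc0 v hv]
      have h1 : (u.support.toLeft.filter fun e => e.1 ∈ C ∧ e.1 = v) = ∅ :=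
        Finset.filter_eq_empty_iff.mpr fun e _ h => hv (h.2 ▸ h.1)
      have h2 : (u.support.toLeft.filter fun e => e.1 ∈ C ∧ e.2 = v) = ∅ :=
        Finset.filter_eq_empty_iff.mpr fun e he h =>
          hv (h.2 ▸ (hC e.1 e.2 (Finset.mem_toLeft.mp he)).mp h.1)
      rw [h1, h2]
      simp

/-- The atomic measure supplied by the factories in a flow. -/
def supply (x : Fin k → Pt m) (u : (Pt m × Pt m) ⊕ Fin k →₀ ℝ) : Pt m →₀ ℝ :=
  ∑ i, Finsupp.single (x i) (u (Sum.inr i))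

lemma supply_apply (x : Fin k → Pt m) (u : (Pt m × Pt m) ⊕ Fin k →₀ ℝ) (z : Pt m) :
    supply x u z = ∑ i with x i = z, u (Sum.inr i) := by
  rw [supply, Finsupp.finsetSum_apply, Finset.sum_filter]
  simp only [Finsupp.single_apply]

lemma support_sum_single_subset {ι : Type*} (s : Finset ι) (z : ι → Pt m) (t : ι → ℝ) :
    (↑(∑ i ∈ s, Finsupp.single (z i) (t i)).support : Set (Pt m)) ⊆ Set.range z := by
  intro v hv
  by_contra hne
  refine Finsupp.mem_support_iff.mp hv ?_
  rw [Finsupp.finsetSum_apply]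
  exact Finset.sum_eq_zero fun i _ => Finsupp.single_eq_of_ne fun h => hne ⟨i, h.symm⟩

lemma massOf_sum_single {ι : Type*} (s : Finset ι) (z : ι → Pt m) (t : ι → ℝ) :
    massOf (∑ i ∈ s, Finsupp.single (z i) (t i)) = ∑ i ∈ s, t i := by
  have h : ∀ c : Pt m →₀ ℝ, massOf c = Finsupp.linearCombination ℝ (fun _ => (1 : ℝ)) c := by
    intro c
    simp [massOf, Finsupp.linearCombination_apply]
  rw [h, map_sum]
  simp

/-- A basic flow to `b` is a transport path from the supplied measure to `b`. -/
lemma IsFlow.isTransportPath {X : Set (Pt m)} {x : Fin k → Pt m} (hxX : ∀ i, x i ∈ X)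
    {b : Pt m →₀ ℝ} (hbX : ↑b.support ⊆ X) {u : (Pt m × Pt m) ⊕ Fin k →₀ ℝ}
    (hu : IsFlow X x b u) (hb : IsBasic (bdry x) u) :
    IsTransportPath X (flowGraph ((supply x u).support ∪ b.support) Set.univ u)
      (supply x u) b :=
  isTransportPath_flowGraph hu hb Set.univ (by simp)
    ((support_sum_single_subset _ _ _).trans (Set.range_subset_iff.mpr hxX)) hbX
    (fun z _ => supply_apply x u z) (by simp) (fun _ _ => rfl) (by simp)

lemma cost_flowGraph (V₀ : Finset (Pt m)) (C : Set (Pt m))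
    (u : (Pt m × Pt m) ⊕ Fin k →₀ ℝ) :
    WDG.cost α (flowGraph V₀ C u) =
      ∑ e ∈ u.support.toLeft with e.1 ∈ C, u (Sum.inl e) ^ α * dist e.1 e.2 := rfl

lemma IsFlow.exists_isAllocPath {X : Set (Pt m)} {x : Fin k → Pt m} (hxX : ∀ i, x i ∈ X)
    {y : Fin ℓ → Pt m} (hyX : ∀ j, y j ∈ X) {n : Fin ℓ → ℝ} (hnsum : ∑ j, n j = 1)
    {u : (Pt m × Pt m) ⊕ Fin k →₀ ℝ} (hu : IsFlow X x (bMeas y n) u)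
    (hb : IsBasic (bdry x) u) :
    ∃ G : WDG m, IsAllocPath X x y n G ∧ WDG.cost α G = flowCost α (edgeLen id) u := by
  refine ⟨_, ⟨supply x u, fun z => ?_, support_sum_single_subset _ _ _, ?_,
    hu.isTransportPath hxX
      ((support_sum_single_subset _ _ _).trans (Set.range_subset_iff.mpr hyX)) hb⟩, ?_⟩
  · rw [supply_apply]
    exact Finset.sum_nonneg fun i _ => hu.nonneg _
  · rw [supply, massOf_sum_single, hu.sum_supply, bMeas, massOf_sum_single, hnsum]
  · rw [cost_flowGraph, flowCost_edgeLen]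
    simp

lemma WDG.cost_nonneg_of_edgesOK {G : WDG m} (h : G.edgesOK) : 0 ≤ WDG.cost α G :=
  Finset.sum_nonneg fun e he =>
    mul_nonneg (Real.rpow_nonneg (h e he).2.2.2.le _) dist_nonneg

lemma dCost_le {X : Set (Pt m)} {a b : Pt m →₀ ℝ} {G : WDG m} (h : IsTransportPath X G a b) :
    dCost X α a b ≤ WDG.cost α G := by
  refine csInf_le ⟨0, ?_⟩ ⟨G, h, rfl⟩
  rintro _ ⟨G', hG', rfl⟩
  exact WDG.cost_nonneg_of_edgesOK hG'.1

/-- The edges of a graph as a flow without supply. -/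
def graphFlow (k : ℕ) (G : WDG m) : (Pt m × Pt m) ⊕ Fin k →₀ ℝ :=
  ∑ e ∈ G.E, Finsupp.single (Sum.inl e) (G.w e)

lemma graphFlow_nonneg {G : WDG m} (h : G.edgesOK) (e : (Pt m × Pt m) ⊕ Fin k) :
    0 ≤ graphFlow k G e := by
  rw [graphFlow, Finsupp.finsetSum_apply]
  refine Finset.sum_nonneg fun d hd => ?_
  rw [Finsupp.single_apply]
  split_ifs
  · exact (h d hd).2.2.2.le
  · exact le_rfl

lemma mem_of_mem_support_graphFlow {X : Set (Pt m)} {a b : Pt m →₀ ℝ} {G : WDG m}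
    (h : IsTransportPath X G a b) {p q : Pt m}
    (hpq : (Sum.inl (p, q) : (Pt m × Pt m) ⊕ Fin k) ∈ (graphFlow k G).support) :
    p ∈ X ∧ q ∈ X := by
  have hE : (p, q) ∈ G.E := by
    by_contra hne
    refine Finsupp.mem_support_iff.mp hpq ?_
    rw [graphFlow, Finsupp.finsetSum_apply]
    refine Finset.sum_eq_zero fun e he => Finsupp.single_eq_of_ne fun h => hne ?_
    rwa [Sum.inl_injective h]
  exact ⟨h.2.1 (h.1 _ hE).1, h.2.1 (h.1 _ hE).2.1⟩

lemma bdry_graphFlow {X : Set (Pt m)} {a b : Pt m →₀ ℝ} {G : WDG m}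
    (h : IsTransportPath X G a b) (x : Fin k → Pt m) : bdry x (graphFlow k G) = a - b := by
  ext v
  rw [Finsupp.sub_apply, ← h.2.2.2.2.2 v, graphFlow, map_sum, Finsupp.finsetSum_apply,
    WDG.outflow, WDG.inflow, Finset.sum_filter, Finset.sum_filter, ← Finset.sum_sub_distrib]
  refine Finset.sum_congr rfl fun e _ => ?_
  rw [bdry_single_inl, Finsupp.sub_apply, Finsupp.single_apply, Finsupp.single_apply]

lemma flowCost_graphFlow_le (hα0 : 0 ≤ α) (hα1 : α ≤ 1) {G : WDG m} (h : G.edgesOK) :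
    flowCost α (edgeLen id) (graphFlow k G) ≤ WDG.cost α G := by
  refine (flowCost_sum_le hα0 hα1 (edgeLen_nonneg id) _ _ fun e he d => ?_).trans
    (Finset.sum_le_sum fun e he => flowCost_single_le (edgeLen_nonneg id) _ (h e he).2.2.2.le)
  rw [Finsupp.single_apply]
  split_ifs
  · exact (h e he).2.2.2.le
  · exact le_rfl

/-- The combination of transport paths from atoms at the factories is a flow. -/
lemma exists_isFlow_of_isTransportPath (hα0 : 0 ≤ α) (hα1 : α ≤ 1) {X : Set (Pt m)}
    {x : Fin k → Pt m} {κ : Type*} (s : Finset κ) (a b : κ → Pt m →₀ ℝ) (G : κ → WDG m)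
    (hG : ∀ r ∈ s, IsTransportPath X (G r) (a r) (b r)) (t : Fin k → ℝ) (ht : ∀ i, 0 ≤ t i)
    (hta : ∑ r ∈ s, a r = ∑ i, Finsupp.single (x i) (t i)) :
    ∃ u, IsFlow X x (∑ r ∈ s, b r) u ∧
      flowCost α (edgeLen id) u ≤ ∑ r ∈ s, WDG.cost α (G r) := by
  have hnn : ∀ e, 0 ≤ (∑ r ∈ s, graphFlow k (G r)) e := by
    intro e
    rw [Finsupp.finsetSum_apply]
    exact Finset.sum_nonneg fun r hr => graphFlow_nonneg (hG r hr).1 e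
  have htn : ∀ i ∈ (Finset.univ : Finset (Fin k)), ∀ e : (Pt m × Pt m) ⊕ Fin k,
      0 ≤ Finsupp.single (Sum.inr i : (Pt m × Pt m) ⊕ Fin k) (t i) e := by
    intro i _ e
    rw [Finsupp.single_apply]
    split_ifs
    · exact ht i
    · exact le_rfl
  have htn' : ∀ e : (Pt m × Pt m) ⊕ Fin k,
      0 ≤ (∑ i, Finsupp.single (Sum.inr i : (Pt m × Pt m) ⊕ Fin k) (t i)) e := by
    intro e
    rw [Finsupp.finsetSum_apply]
    exact Finset.sum_nonneg fun i hi => htn i hi e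
  refine ⟨∑ r ∈ s, graphFlow k (G r) + ∑ i, Finsupp.single (Sum.inr i) (t i),
    ⟨fun e => add_nonneg (hnn e) (htn' e), fun p q hpq => ?_, ?_⟩, ?_⟩
  · have h0 : (∑ i, Finsupp.single (Sum.inr i : (Pt m × Pt m) ⊕ Fin k) (t i))
        (Sum.inl (p, q)) = 0 := by
      rw [Finsupp.finsetSum_apply]
      exact Finset.sum_eq_zero fun i _ => Finsupp.single_eq_of_ne (by simp)
    rw [Finsupp.mem_support_iff, Finsupp.add_apply, h0, add_zero, Finsupp.finsetSum_apply] at hpq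
    obtain ⟨r, hr, hne⟩ := Finset.exists_ne_zero_of_sum_ne_zero hpq
    exact mem_of_mem_support_graphFlow (hG r hr) (Finsupp.mem_support_iff.mpr hne)
  · rw [map_add, map_sum, map_sum, Finset.sum_congr rfl fun r hr => bdry_graphFlow (hG r hr) x,
      Finset.sum_sub_distrib, hta]
    simp only [bdry_single_inr, Finset.sum_neg_distrib]
    abel
  · refine (flowCost_add_le hα0 hα1 (edgeLen_nonneg id) hnn htn').trans ?_
    have h1 := flowCost_sum_le hα0 hα1 (edgeLen_nonneg (id : Pt m → Pt m)) s
      (fun r => graphFlow k (G r)) (fun r hr e => graphFlow_nonneg (hG r hr).1 e)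
    have h2 := flowCost_sum_le hα0 hα1 (edgeLen_nonneg (id : Pt m → Pt m)) Finset.univ
      (fun i => Finsupp.single (Sum.inr i : (Pt m × Pt m) ⊕ Fin k) (t i)) htn
    have h3 : ∑ i, flowCost α (edgeLen (id : Pt m → Pt m))
        (Finsupp.single (Sum.inr i : (Pt m × Pt m) ⊕ Fin k) (t i)) ≤ 0 := by
      refine Finset.sum_nonpos fun i _ => ?_
      refine (flowCost_single_le (edgeLen_nonneg id) _ (ht i)).trans (le_of_eq ?_)
      simp [edgeLen]
    have h4 := Finset.sum_le_sum fun r hr =>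
      flowCost_graphFlow_le (k := k) hα0 hα1 (hG r hr).1
    linarith

/-- There is a flow from any factory to any nonnegative atomic measure. -/
lemma exists_isFlow_star {X : Set (Pt m)} {x : Fin k → Pt m} (hxX : ∀ i, x i ∈ X)
    {y : Fin ℓ → Pt m} (hyX : ∀ j, y j ∈ X) {n : Fin ℓ → ℝ} (hn : ∀ j, 0 ≤ n j)
    (s : Finset (Fin ℓ)) (i : Fin k) :
    ∃ u, IsFlow X x (∑ j ∈ s, Finsupp.single (y j) (n j)) u ∧
      ∀ i', Sum.inr i' ∈ u.support → i' = i := by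
  have hs0 : 0 ≤ ∑ j ∈ s, n j := Finset.sum_nonneg fun j _ => hn j
  refine ⟨∑ j ∈ s, Finsupp.single (Sum.inl (x i, y j)) (n j) +
    Finsupp.single (Sum.inr i) (∑ j ∈ s, n j), ⟨fun e => ?_, fun p q h => ?_, ?_⟩, fun i' h => ?_⟩
  · rw [Finsupp.add_apply, Finsupp.finsetSum_apply]
    refine add_nonneg (Finset.sum_nonneg fun j _ => ?_) ?_
    · rw [Finsupp.single_apply]
      split_ifs
      exacts [hn j, le_rfl]
    · rw [Finsupp.single_apply]
      split_ifs
      exacts [hs0, le_rfl]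
  · rw [Finsupp.mem_support_iff, Finsupp.add_apply, Finsupp.single_eq_of_ne (by simp), add_zero,
      Finsupp.finsetSum_apply] at h
    obtain ⟨j, _, hne⟩ := Finset.exists_ne_zero_of_sum_ne_zero h
    rw [Finsupp.single_apply_ne_zero] at hne
    obtain ⟨rfl, rfl⟩ := Prod.mk.inj (Sum.inl_injective hne.1)
    exact ⟨hxX i, hyX j⟩
  · rw [map_add, map_sum, bdry_single_inr]
    simp only [bdry_single_inl]
    rw [Finset.sum_sub_distrib, ← Finsupp.single_finsetSum]
    abel
  · by_contra hne
    refine Finsupp.mem_support_iff.mp h ?_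
    rw [Finsupp.add_apply, Finsupp.single_eq_of_ne (by simpa using hne), add_zero,
      Finsupp.finsetSum_apply]
    exact Finset.sum_eq_zero fun j _ => Finsupp.single_eq_of_ne (by simp)

end Graphs

/-! ### Assignment maps -/

section Assignment

variable {m k ℓ : ℕ} {α : ℝ}

lemma sum_single_filter_apply {κ : Type*} (s : Finset κ) (z : κ → Pt m) (t : κ → ℝ) (v : Pt m) :
    (∑ r ∈ s, Finsupp.single (z r) (t r)) v = ∑ r ∈ s, if z r = v then t r else 0 := by
  rw [Finsupp.finsetSum_apply]
  exact Finset.sum_congr rfl fun r _ => by rw [Finsupp.single_apply]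

/-- The balance of a flow over a set of vertices that is closed under its edges. -/
lemma IsFlow.sum_supply_eq {X : Set (Pt m)} {x : Fin k → Pt m} {y : Fin ℓ → Pt m}
    {n : Fin ℓ → ℝ} {u : (Pt m × Pt m) ⊕ Fin k →₀ ℝ} (hu : IsFlow X x (bMeas y n) u)
    {C : Set (Pt m)} (hC : ∀ p q, Sum.inl (p, q) ∈ u.support → (p ∈ C ↔ q ∈ C)) :
    ∑ i, (if x i ∈ C then u (Sum.inr i) else 0) = ∑ j, if y j ∈ C then n j else 0 := by
  have h := linearCombination_bdry x (fun z => if z ∈ C then (1 : ℝ) else 0) u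
  rw [Finset.sum_eq_zero, hu.bdry_eq, map_neg, bMeas, map_sum, zero_sub, neg_inj] at h
  · simpa [Finsupp.linearCombination_single] using h.symm
  · rintro ⟨p, q⟩ he
    simp [hC p q (Finset.mem_toLeft.mp he)]

lemma IsFlow.exists_assignment {X : Set (Pt m)} {x : Fin k → Pt m} (hxX : ∀ i, x i ∈ X)
    {y : Fin ℓ → Pt m} (hyX : ∀ j, y j ∈ X) {n : Fin ℓ → ℝ} (hn : ∀ j, 0 < n j)
    {u : (Pt m × Pt m) ⊕ Fin k →₀ ℝ} (hu : IsFlow X x (bMeas y n) u)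
    (hb : IsBasic (bdry x) u) :
    ∃ S : Fin ℓ → Fin k, Ealpha X α x y n S ≤ flowCost α (edgeLen id) u := by
  set H : SimpleGraph (Pt m) := SimpleGraph.fromRel fun p q => (p, q) ∈ u.support.toLeft with hH
  have hadj : ∀ p q, Sum.inl (p, q) ∈ u.support → H.Adj p q := fun p q h =>
    (SimpleGraph.fromRel_adj _ _ _).mpr ⟨hb.ne h, Or.inl (Finset.mem_toLeft.mpr h)⟩
  have hcl : ∀ r p q, Sum.inl (p, q) ∈ u.support → (H.Reachable r p ↔ H.Reachable r q) :=
    fun r p q h => ⟨fun h' => h'.trans (hadj p q h).reachable,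
      fun h' => h'.trans (hadj p q h).symm.reachable⟩
  have huniq : ∀ i i', Sum.inr i ∈ u.support → Sum.inr i' ∈ u.support →
      H.Reachable (x i) (x i') → i = i' := fun i i' hi hi' h =>
    hb.eq_of_reachable (fun e he => Finset.mem_toLeft.mp he) hi hi' h
  have hex : ∀ j, ∃ i, Sum.inr i ∈ u.support ∧ H.Reachable (x i) (y j) := by
    intro j
    by_contra! hcon
    have h := hu.sum_supply_eq (C := {p | H.Reachable (y j) p}) (hcl (y j))
    rw [Finset.sum_eq_zero] at h
    · have h1 : n j ≤ ∑ j', if y j' ∈ {p | H.Reachable (y j) p} then n j' else 0 := by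
        refine le_trans (le_of_eq ?_) (Finset.single_le_sum (f := fun j' =>
          if y j' ∈ {p | H.Reachable (y j) p} then n j' else 0) (fun j' _ => ?_)
          (Finset.mem_univ j))
        · exact (if_pos (SimpleGraph.Reachable.refl _)).symm
        · split_ifs
          exacts [(hn j').le, le_rfl]
      linarith [hn j]
    · intro i _
      split_ifs with hi
      · by_contra hne
        exact hcon i (Finsupp.mem_support_iff.mpr hne) hi.symm
      · rfl
  choose S hS hSr using hex
  have hSeq : ∀ i j, Sum.inr i ∈ u.support → H.Reachable (x i) (y j) → S j = i :=
    fun i j hi h => huniq _ _ (hS j) hi ((hSr j).trans h.symm)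
  let C : Fin k → Set (Pt m) := fun i => {p | Sum.inr i ∈ u.support ∧ H.Reachable (x i) p}
  have hC : ∀ i p q, Sum.inl (p, q) ∈ u.support → (p ∈ C i ↔ q ∈ C i) := fun i p q h =>
    and_congr_right fun _ => hcl (x i) p q h
  have hyC : ∀ i j, y j ∈ C i ↔ S j = i := fun i j =>
    ⟨fun h => hSeq i j h.1 h.2, fun h => h ▸ ⟨hS j, hSr j⟩⟩
  have hxC : ∀ i i', x i' ∈ C i → u (Sum.inr i') ≠ 0 → i' = i := fun i i' h h0 =>
    (huniq _ _ h.1 (Finsupp.mem_support_iff.mpr h0) h.2).symm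
  have hmB : ∀ i, mB n S i = u (Sum.inr i) := by
    intro i
    have h := hu.sum_supply_eq (hC i)
    simp only [hyC] at h
    rw [mB, Finset.sum_filter, ← h, Finset.sum_eq_single i]
    · split_ifs with hi
      · rfl
      · by_contra hne
        exact hi ⟨Finsupp.mem_support_iff.mpr (Ne.symm hne), SimpleGraph.Reachable.refl _⟩
    · intro i' _ hne
      split_ifs with hi
      · by_contra h0
        exact hne (hxC i i' hi h0)
      · rfl
    · simp
  have hpath : ∀ i, IsTransportPath X (flowGraph ((Finsupp.single (x i) (mB n S i)).support ∪
      (bPart y n S i).support) (C i) u) (Finsupp.single (x i) (mB n S i)) (bPart y n S i) := by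
    intro i
    refine isTransportPath_flowGraph hu hb (C i) (hC i) ?_ ?_ ?_ ?_ ?_ ?_
    · intro z hz
      rw [Finset.mem_singleton.mp (Finsupp.support_single_subset hz)]
      exact hxX i
    · exact (support_sum_single_subset _ _ _).trans (Set.range_subset_iff.mpr hyX)
    · intro z hz
      rw [Finsupp.single_apply, hmB, Finset.sum_filter, Finset.sum_eq_single i]
      · intro i' _ hne
        split_ifs with hi
        · by_contra h0
          exact hne (hxC i i' (hi ▸ hz) h0)
        · rfl
      · simp
    · intro z hz
      rw [Finsupp.single_apply, hmB]
      split_ifs with hi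
      · by_contra h0
        exact hz ⟨Finsupp.mem_support_iff.mpr h0, hi ▸ SimpleGraph.Reachable.refl _⟩
      · rfl
    · intro z hz
      rw [bPart, bMeas, sum_single_filter_apply, sum_single_filter_apply, Finset.sum_filter]
      refine Finset.sum_congr rfl fun j _ => ?_
      by_cases hj : y j = z
      · rw [if_pos ((hyC i j).mp (hj ▸ hz))]
      · simp [hj]
    · intro z hz
      rw [bPart, sum_single_filter_apply, Finset.sum_filter]
      refine Finset.sum_eq_zero fun j _ => ?_
      split_ifs with h1 h2
      · exact absurd (h2 ▸ (hyC i j).mpr h1) hz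
      · rfl
      · rfl
  refine ⟨S, (Finset.sum_le_sum fun i _ => dCost_le (α := α) (hpath i)).trans ?_⟩
  simp only [cost_flowGraph]
  rw [flowCost_edgeLen]
  simp only [Finset.sum_filter]
  rw [Finset.sum_comm]
  refine Finset.sum_le_sum fun e _ => ?_
  have h0 : 0 ≤ u (Sum.inl e) ^ α * dist e.1 e.2 :=
    mul_nonneg (Real.rpow_nonneg (hu.nonneg _) _) dist_nonneg
  by_cases hi : ∃ i, e.1 ∈ C i
  · obtain ⟨i, hi⟩ := hi
    rw [Finset.sum_eq_single i]
    · rw [if_pos hi]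
      exact le_rfl
    · intro i' _ hne
      rw [if_neg]
      exact fun h => hne (huniq _ _ h.1 hi.1 (h.2.trans hi.2.symm))
    · simp
  · push Not at hi
    exact (Finset.sum_eq_zero fun i _ => if_neg (hi i)).trans_le h0

lemma exists_isTransportPath_bPart (hα0 : 0 ≤ α) (hα1 : α ≤ 1) {X : Set (Pt m)}
    {x : Fin k → Pt m} (hxX : ∀ i, x i ∈ X) {y : Fin ℓ → Pt m} (hyX : ∀ j, y j ∈ X)
    {n : Fin ℓ → ℝ} (hn : ∀ j, 0 ≤ n j) (S : Fin ℓ → Fin k) (i : Fin k) :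
    ∃ G, IsTransportPath X G (Finsupp.single (x i) (mB n S i)) (bPart y n S i) := by
  obtain ⟨u₀, hu₀, hsupp⟩ := exists_isFlow_star hxX hyX hn
    (Finset.univ.filter fun j => S j = i) i
  obtain ⟨u, hu, hus, -, hb⟩ := hu₀.exists_isBasic hα0 hα1
  have h0 : ∀ i', i' ≠ i → u (Sum.inr i') = 0 := by
    intro i' hne
    by_contra h
    exact hne (hsupp i' (hus (Finsupp.mem_support_iff.mpr h)))
  have hmass : u (Sum.inr i) = mB n S i := by
    have h := hu.sum_supply
    rw [massOf_sum_single, Finset.sum_eq_single i (fun i' _ hne => h0 i' hne) (by simp)] at h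
    exact h
  have hsup : supply x u = Finsupp.single (x i) (mB n S i) := by
    rw [supply, Finset.sum_eq_single i _ (by simp), hmass]
    intro i' _ hne
    rw [h0 i' hne, Finsupp.single_zero]
  have h := hu.isTransportPath hxX
    ((support_sum_single_subset _ _ _).trans (Set.range_subset_iff.mpr hyX)) hb
  rw [hsup] at h
  exact ⟨_, h⟩

lemma sum_bPart (y : Fin ℓ → Pt m) (n : Fin ℓ → ℝ) (S : Fin ℓ → Fin k) :
    ∑ i, bPart y n S i = bMeas y n := by
  simp only [bPart, bMeas]
  exact Finset.sum_fiberwise _ _ _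

/-- A lower bound for the cost of flows is a lower bound for the cost of assignment maps. -/
lemma le_Ealpha (hα0 : 0 ≤ α) (hα1 : α ≤ 1) {X : Set (Pt m)}
    {x : Fin k → Pt m} (hxX : ∀ i, x i ∈ X) {y : Fin ℓ → Pt m} (hyX : ∀ j, y j ∈ X)
    {n : Fin ℓ → ℝ} (hn : ∀ j, 0 ≤ n j) (hk : 0 < k) {c : ℝ}
    (hc : ∀ u, IsFlow X x (bMeas y n) u → c ≤ flowCost α (edgeLen id) u)
    (S : Fin ℓ → Fin k) : c ≤ Ealpha X α x y n S := by
  have hk' : (0 : ℝ) < k := by exact_mod_cast hk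
  refine le_of_forall_pos_le_add fun ε hε => ?_
  have hG : ∀ i, ∃ G, IsTransportPath X G (Finsupp.single (x i) (mB n S i)) (bPart y n S i) ∧
      WDG.cost α G < dCost X α (Finsupp.single (x i) (mB n S i)) (bPart y n S i) + ε / k := by
    intro i
    obtain ⟨G₀, hG₀⟩ := exists_isTransportPath_bPart hα0 hα1 hxX hyX hn S i
    obtain ⟨_, ⟨G, hG, rfl⟩, hlt⟩ := exists_lt_of_csInf_lt (⟨_, G₀, hG₀, rfl⟩ :
      (WDG.cost α '' {G : WDG m | IsTransportPath X G (Finsupp.single (x i) (mB n S i))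
        (bPart y n S i)}).Nonempty) (lt_add_of_pos_right _ (div_pos hε hk'))
    exact ⟨G, hG, hlt⟩
  choose G hG hlt using hG
  obtain ⟨u, hu, hcost⟩ := exists_isFlow_of_isTransportPath hα0 hα1 Finset.univ _ _ G
    (fun i _ => hG i) (mB n S) (fun i => Finset.sum_nonneg fun j _ => hn j) rfl
  rw [sum_bPart] at hu
  refine (hc u hu).trans (hcost.trans ((Finset.sum_le_sum fun i _ => (hlt i).le).trans ?_))
  rw [Finset.sum_add_distrib, Finset.sum_const, Finset.card_univ, Fintype.card_fin, nsmul_eq_mul,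
    mul_div_cancel₀ _ hk'.ne']
  exact le_rfl

/-- A lower bound for the cost of flows is a lower bound for the cost of allocation paths. -/
lemma IsAllocPath.le_cost (hα0 : 0 ≤ α) (hα1 : α ≤ 1) {X : Set (Pt m)}
    {x : Fin k → Pt m} (hxinj : Function.Injective x) {y : Fin ℓ → Pt m}
    {n : Fin ℓ → ℝ} {c : ℝ}
    (hc : ∀ u, IsFlow X x (bMeas y n) u → c ≤ flowCost α (edgeLen id) u)
    {G : WDG m} (hG : IsAllocPath X x y n G) : c ≤ WDG.cost α G := by
  obtain ⟨a, ha, hax, -, hG⟩ := hG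
  have hsum : a = ∑ i, Finsupp.single (x i) (a (x i)) := by
    ext z
    rw [sum_single_filter_apply]
    by_cases hz : a z = 0
    · rw [hz, Finset.sum_eq_zero]
      intro i _
      split_ifs with h
      exacts [h ▸ hz, rfl]
    · obtain ⟨i, rfl⟩ := hax (Finsupp.mem_support_iff.mpr hz)
      simp [hxinj.eq_iff]
  obtain ⟨u, hu, hcost⟩ := exists_isFlow_of_isTransportPath hα0 hα1 {()} (fun _ => a)
    (fun _ => bMeas y n) (fun _ => G) (fun _ _ => hG) (fun i => a (x i)) (fun i => ha _)
    (by simpa using hsum)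
  simp only [Finset.sum_singleton] at hu hcost
  exact (hc u hu).trans hcost

end Assignment

/-! ### Bounding the number of branching points -/

section Bound

variable {m k : ℕ} {α : ℝ}

/-- The vertices touched by the edges of a flow. -/
def flowVerts (u : (Pt m × Pt m) ⊕ Fin k →₀ ℝ) : Finset (Pt m) :=
  u.support.toLeft.image Prod.fst ∪ u.support.toLeft.image Prod.snd

lemma fst_mem_flowVerts {u : (Pt m × Pt m) ⊕ Fin k →₀ ℝ} {e : Pt m × Pt m}
    (he : e ∈ u.support.toLeft) :
    e.1 ∈ flowVerts u :=
  Finset.mem_union_left _ (Finset.mem_image_of_mem _ he)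

lemma snd_mem_flowVerts {u : (Pt m × Pt m) ⊕ Fin k →₀ ℝ} {e : Pt m × Pt m}
    (he : e ∈ u.support.toLeft) :
    e.2 ∈ flowVerts u :=
  Finset.mem_union_right _ (Finset.mem_image_of_mem _ he)

lemma IsBasic.card_edges_le {x : Fin k → Pt m} {u : (Pt m × Pt m) ⊕ Fin k →₀ ℝ}
    (hb : IsBasic (bdry x) u) : u.support.toLeft.card ≤ (flowVerts u).card := by
  let f : u.support.toLeft → (Pt m × Pt m) ⊕ Fin k := fun e => Sum.inl e.1
  have hf : Function.Injective f := Sum.inl_injective.comp Subtype.val_injective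
  have hli : LinearIndependent ℝ (edgeBdry x ∘ f) := by
    rw [linearIndependent_iff]
    intro l hl
    rw [← Finsupp.linearCombination_mapDomain] at hl
    have h0 := hb (Finsupp.mapDomain f l) (fun e he => by
      obtain ⟨d, _, rfl⟩ := Finset.mem_image.mp (Finsupp.mapDomain_support he)
      exact Finset.mem_toLeft.mp d.2) hl
    exact Finsupp.mapDomain_injective hf (h0.trans Finsupp.mapDomain_zero.symm)
  have h := linearIndependent_le_span' (edgeBdry x ∘ f) hli
    (((flowVerts u).image fun v => Finsupp.single v (1 : ℝ) : Finset (Pt m →₀ ℝ)) :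
      Set (Pt m →₀ ℝ)) (by
      rintro _ ⟨e, rfl⟩
      have hv : ∀ v ∈ flowVerts u, Finsupp.single v (1 : ℝ) ∈ Submodule.span ℝ
          (((flowVerts u).image fun v => Finsupp.single v (1 : ℝ) : Finset (Pt m →₀ ℝ)) :
            Set (Pt m →₀ ℝ)) := fun v hv =>
        Submodule.subset_span (Finset.mem_coe.mpr (Finset.mem_image_of_mem _ hv))
      exact Submodule.sub_mem _ (hv _ (fst_mem_flowVerts e.2)) (hv _ (snd_mem_flowVerts e.2)))
  rw [Cardinal.mk_fintype, Nat.cast_le, Fintype.card_coe] at h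
  simp only [Finset.coe_sort_coe, Fintype.card_coe] at h
  exact h.trans Finset.card_image_le

/-- Among many vertices outside `T` there is one of degree at most two. -/
lemma IsBasic.exists_degree_le_two {x : Fin k → Pt m} {u : (Pt m × Pt m) ⊕ Fin k →₀ ℝ}
    (hb : IsBasic (bdry x) u) (T : Finset (Pt m)) (hT : 2 * T.card < (flowVerts u \ T).card) :
    ∃ v ∈ flowVerts u, v ∉ T ∧ (u.support.toLeft.filter fun e => e.1 = v).card +
      (u.support.toLeft.filter fun e => e.2 = v).card ≤ 2 := by
  by_contra! hcon
  have h1 : u.support.toLeft.card = ∑ v ∈ flowVerts u,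
      (u.support.toLeft.filter fun e => e.1 = v).card :=
    Finset.card_eq_sum_card_fiberwise fun e he => fst_mem_flowVerts he
  have h2 : u.support.toLeft.card = ∑ v ∈ flowVerts u,
      (u.support.toLeft.filter fun e => e.2 = v).card :=
    Finset.card_eq_sum_card_fiberwise fun e he => snd_mem_flowVerts he
  have h3 : ∑ v ∈ flowVerts u \ T, 3 ≤ ∑ v ∈ flowVerts u \ T,
      ((u.support.toLeft.filter fun e => e.1 = v).card +
        (u.support.toLeft.filter fun e => e.2 = v).card) :=
    Finset.sum_le_sum fun v hv =>
      hcon v (Finset.mem_sdiff.mp hv).1 (Finset.mem_sdiff.mp hv).2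
  have h4 := h3.trans (Finset.sum_le_sum_of_subset (Finset.sdiff_subset (s := flowVerts u)))
  rw [Finset.sum_add_distrib, ← h1, ← h2, Finset.sum_const, smul_eq_mul] at h4
  have h5 := hb.card_edges_le
  have h6 := Finset.card_le_card_sdiff_add_card (s := flowVerts u) (t := T)
  omega

lemma mapDomain_eq_self {φ : Pt m → Pt m} {c : Pt m →₀ ℝ} (h : ∀ z ∈ c.support, φ z = z) :
    Finsupp.mapDomain φ c = c := by
  rw [Finsupp.mapDomain_congr (g := id) h, Finsupp.mapDomain_id]

/-- A vertex of degree at most two which is neither a source nor a sink can be contracted. -/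
lemma IsFlow.exists_contract (hα0 : 0 ≤ α) (hα1 : α ≤ 1) {X : Set (Pt m)} {x : Fin k → Pt m}
    {b : Pt m →₀ ℝ} {u : (Pt m × Pt m) ⊕ Fin k →₀ ℝ} (hu : IsFlow X x b u)
    (hb : IsBasic (bdry x) u) {v : Pt m} (hv : v ∈ flowVerts u) (hvx : ∀ i, x i ≠ v)
    (hvb : b v = 0)
    (hdeg : (u.support.toLeft.filter fun e => e.1 = v).card +
      (u.support.toLeft.filter fun e => e.2 = v).card ≤ 2) :
    ∃ u', IsFlow X x b u' ∧ flowCost α (edgeLen id) u' ≤ flowCost α (edgeLen id) u ∧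
      flowVerts u' ⊂ flowVerts u := by
  have hpos : ∀ e ∈ u.support.toLeft, 0 < u (Sum.inl e) := fun e he =>
    lt_of_le_of_ne (hu.nonneg _) (Ne.symm (Finsupp.mem_support_iff.mp (Finset.mem_toLeft.mp he)))
  have hbal : ∑ e ∈ u.support.toLeft with e.1 = v, u (Sum.inl e) =
      ∑ e ∈ u.support.toLeft with e.2 = v, u (Sum.inl e) := by
    have h := bdry_apply x u v
    have h0 : (Finset.univ.filter fun i => x i = v) = ∅ :=
      Finset.filter_eq_empty_iff.mpr fun i _ => hvx i
    rw [hu.bdry_eq, Finsupp.neg_apply, hvb, h0, Finset.sum_empty, neg_zero, sub_zero] at h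
    exact (sub_eq_zero.mp h.symm)
  have hsumpos : ∀ s : Finset (Pt m × Pt m), s ⊆ u.support.toLeft → s.Nonempty →
      0 < ∑ e ∈ s, u (Sum.inl e) := fun s hs hne =>
    Finset.sum_pos (fun e he => hpos e (hs he)) hne
  have hne : (u.support.toLeft.filter fun e => e.1 = v).Nonempty ∧
      (u.support.toLeft.filter fun e => e.2 = v).Nonempty := by
    have hor : (u.support.toLeft.filter fun e => e.1 = v).Nonempty ∨
        (u.support.toLeft.filter fun e => e.2 = v).Nonempty := by
      rcases Finset.mem_union.mp hv with h | h
      · obtain ⟨e, he, h⟩ := Finset.mem_image.mp h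
        exact Or.inl ⟨e, Finset.mem_filter.mpr ⟨he, h⟩⟩
      · obtain ⟨e, he, h⟩ := Finset.mem_image.mp h
        exact Or.inr ⟨e, Finset.mem_filter.mpr ⟨he, h⟩⟩
    rcases hor with h | h
    · refine ⟨h, Finset.nonempty_of_sum_ne_zero (f := fun e => u (Sum.inl e)) ?_⟩
      rw [← hbal]
      exact (hsumpos _ (Finset.filter_subset _ _) h).ne'
    · refine ⟨Finset.nonempty_of_sum_ne_zero (f := fun e => u (Sum.inl e)) ?_, h⟩
      rw [hbal]
      exact (hsumpos _ (Finset.filter_subset _ _) h).ne'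
  have hc1 := hne.1.card_pos
  have hc2 := hne.2.card_pos
  obtain ⟨e₁, he₁⟩ := Finset.card_eq_one.mp (show
    (u.support.toLeft.filter fun e => e.1 = v).card = 1 by omega)
  obtain ⟨e₂, he₂⟩ := Finset.card_eq_one.mp (show
    (u.support.toLeft.filter fun e => e.2 = v).card = 1 by omega)
  rw [he₁, he₂, Finset.sum_singleton, Finset.sum_singleton] at hbal
  obtain ⟨he₁s, he₁v⟩ := Finset.mem_filter.mp (he₁ ▸ Finset.mem_singleton_self e₁)
  obtain ⟨he₂s, he₂v⟩ := Finset.mem_filter.mp (he₂ ▸ Finset.mem_singleton_self e₂)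
  have hout : ∀ e ∈ u.support.toLeft, e.1 = v → e = e₁ := fun e he h =>
    Finset.mem_singleton.mp (he₁ ▸ Finset.mem_filter.mpr ⟨he, h⟩)
  have hin : ∀ e ∈ u.support.toLeft, e.2 = v → e = e₂ := fun e he h =>
    Finset.mem_singleton.mp (he₂ ▸ Finset.mem_filter.mpr ⟨he, h⟩)
  have hloop₁ : e₁.2 ≠ v := fun h => hb.ne (Finset.mem_toLeft.mp he₁s) (he₁v.trans h.symm)
  have hloop₂ : e₂.1 ≠ v := fun h => hb.ne (Finset.mem_toLeft.mp he₂s) (h.trans he₂v.symm)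
  have h12 : e₂ ≠ e₁ := fun h => hloop₂ (h ▸ he₁v)
  let φ : Pt m → Pt m := fun z => if z = v then e₂.1 else z
  have hφv : φ v = e₂.1 := if_pos rfl
  have hφ : ∀ z, z ≠ v → φ z = z := fun z hz => if_neg hz
  have hφne : ∀ z, φ z ≠ v := by
    intro z
    by_cases hz : z = v
    · rw [hz, hφv]
      exact hloop₂
    · rwa [hφ z hz]
  have hφX : ∀ (C : Set (Pt m)), e₂.1 ∈ C → ∀ z ∈ C, φ z ∈ C := by
    intro C h z hz
    by_cases hzv : z = v
    · rwa [hzv, hφv]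
    · rwa [hφ z hzv]
  have hmem : ∀ p q, Sum.inl (p, q) ∈ (Finsupp.mapDomain (edgeMap φ) u).support →
      ∃ p' q', Sum.inl (p', q') ∈ u.support ∧ φ p' = p ∧ φ q' = q := by
    intro p q h
    obtain ⟨e, he, h⟩ := Finset.mem_image.mp (Finsupp.mapDomain_support h)
    rcases e with ⟨p', q'⟩ | i
    · obtain ⟨h1, h2⟩ := Prod.mk.inj (Sum.inl_injective h)
      exact ⟨p', q', he, h1, h2⟩
    · exact absurd h (by simp [edgeMap])
  have he₂X := (hu.mem e₂.1 e₂.2 (Finset.mem_toLeft.mp he₂s)).1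
  have hverts : ∀ z ∈ flowVerts (Finsupp.mapDomain (edgeMap φ) u : (Pt m × Pt m) ⊕ Fin k →₀ ℝ),
      z ∈ flowVerts u ∧ z ≠ v := by
    have hφV := hφX (flowVerts u) (Finset.mem_coe.mpr (fst_mem_flowVerts he₂s))
    intro z hz
    rcases Finset.mem_union.mp hz with h | h
    · obtain ⟨⟨p, q⟩, he, rfl⟩ := Finset.mem_image.mp h
      obtain ⟨p', q', h', rfl, rfl⟩ := hmem p q (Finset.mem_toLeft.mp he)
      exact ⟨hφV p' (fst_mem_flowVerts (Finset.mem_toLeft.mpr h')), hφne p'⟩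
    · obtain ⟨⟨p, q⟩, he, rfl⟩ := Finset.mem_image.mp h
      obtain ⟨p', q', h', rfl, rfl⟩ := hmem p q (Finset.mem_toLeft.mp he)
      exact ⟨hφV q' (snd_mem_flowVerts (Finset.mem_toLeft.mpr h')), hφne q'⟩
  refine ⟨Finsupp.mapDomain (edgeMap φ) u, ⟨mapDomain_nonneg_of_nonneg _ hu.nonneg, ?_, ?_⟩, ?_, ?_⟩
  · intro p q h
    obtain ⟨p', q', h', rfl, rfl⟩ := hmem p q h
    exact ⟨hφX X he₂X _ (hu.mem p' q' h').1, hφX X he₂X _ (hu.mem p' q' h').2⟩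
  · have hx : φ ∘ x = x := funext fun i => hφ _ (hvx i)
    have h := bdry_mapDomain x φ u
    rw [hx, hu.bdry_eq] at h
    rw [h, mapDomain_eq_self]
    intro z hz
    refine hφ z ?_
    rintro rfl
    rw [Finsupp.support_neg] at hz
    exact Finsupp.mem_support_iff.mp hz hvb
  · refine (flowCost_mapDomain_le hα0 hα1 _ (edgeLen_nonneg id) hu.nonneg).trans ?_
    rw [edgeLen_comp_edgeMap, Function.id_comp, flowCost_edgeLen, flowCost_edgeLen,
      ← Finset.add_sum_erase _ _ he₁s, ← Finset.add_sum_erase _ _ he₁s,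
      ← Finset.add_sum_erase _ _ (Finset.mem_erase.mpr ⟨h12, he₂s⟩),
      ← Finset.add_sum_erase _ _ (Finset.mem_erase.mpr ⟨h12, he₂s⟩), ← add_assoc, ← add_assoc]
    refine add_le_add ?_ (Finset.sum_le_sum fun e he => ?_)
    · rw [he₁v, he₂v, hφv, hφ _ hloop₁, hφ _ hloop₂, hbal, dist_self, mul_zero, add_zero,
        ← mul_add]
      refine mul_le_mul_of_nonneg_left ?_ (Real.rpow_nonneg (hu.nonneg _) _)
      rw [add_comm]
      exact dist_triangle _ _ _
    · obtain ⟨hne₂, he⟩ := Finset.mem_erase.mp he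
      obtain ⟨hne₁, he⟩ := Finset.mem_erase.mp he
      rw [hφ _ fun h => hne₁ (hout e he h), hφ _ fun h => hne₂ (hin e he h)]
      exact le_rfl
  · exact (Finset.ssubset_iff_of_subset fun z hz => (hverts z hz).1).mpr
      ⟨v, hv, fun h => (hverts v h).2 rfl⟩

/-- Every flow is dominated by one with few vertices besides the given points `T`. -/
lemma IsFlow.exists_card_verts_le (hα0 : 0 ≤ α) (hα1 : α ≤ 1) {X : Set (Pt m)}
    {x : Fin k → Pt m} {b : Pt m →₀ ℝ} {T : Finset (Pt m)} (hxT : ∀ i, x i ∈ T)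
    (hbT : b.support ⊆ T) (u : (Pt m × Pt m) ⊕ Fin k →₀ ℝ) (hu : IsFlow X x b u) :
    ∃ u', IsFlow X x b u' ∧ flowCost α (edgeLen id) u' ≤ flowCost α (edgeLen id) u ∧
      (flowVerts u' \ T).card ≤ 2 * T.card := by
  induction hc : (flowVerts u).card using Nat.strong_induction_on generalizing u with
  | _ N ih =>
  obtain ⟨u₁, hu₁, hs, hc₁, hb⟩ := hu.exists_isBasic (α := α) hα0 hα1
  by_cases hT : (flowVerts u₁ \ T).card ≤ 2 * T.card
  · exact ⟨u₁, hu₁, hc₁, hT⟩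
  obtain ⟨v, hv, hvT, hdeg⟩ := hb.exists_degree_le_two T (not_le.mp hT)
  obtain ⟨u₂, hu₂, hc₂, hs₂⟩ := hu₁.exists_contract hα0 hα1 hb hv
    (fun i h => hvT (h ▸ hxT i)) (Finsupp.notMem_support_iff.mp fun h => hvT (hbT h)) hdeg
  have hsub : flowVerts u₁ ⊆ flowVerts u := by
    have hl : u₁.support.toLeft ⊆ u.support.toLeft := fun e he =>
      Finset.mem_toLeft.mpr (hs (Finset.mem_toLeft.mp he))
    exact Finset.union_subset_union (Finset.image_subset_image hl) (Finset.image_subset_image hl)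
  obtain ⟨u₃, hu₃, hc₃, hT₃⟩ :=
    ih _ (hc ▸ Finset.card_lt_card (hs₂.trans_subset hsub)) u₂ hu₂ rfl
  exact ⟨u₃, hu₃, hc₃.trans (hc₂.trans hc₁), hT₃⟩

end Bound

/-! ### Existence of a flow of minimal cost -/

section Existence

variable {m k ℓ : ℕ} {α : ℝ}

/-- Only finitely many basic vectors have a given boundary. -/
lemma finite_isBasic {ι M : Type*} [Finite ι] [AddCommGroup M] [Module ℝ M]
    (D : (ι →₀ ℝ) →ₗ[ℝ] M) (c : M) : {w : ι →₀ ℝ | D w = c ∧ IsBasic D w}.Finite := by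
  refine Set.Finite.of_finite_image (f := Finsupp.support) (Set.toFinite _) ?_
  rintro w ⟨hw, hwb⟩ w' ⟨hw', -⟩ h
  refine sub_eq_zero.mp (hwb (w - w') ?_ (by rw [map_sub, hw, hw', sub_self]))
  refine Finsupp.support_sub.trans (Finset.union_subset subset_rfl h.symm.subset)

lemma continuous_flowCost_edgeLen {J Y : Type*} [TopologicalSpace Y] {p : Y → J → Pt m}
    (hp : ∀ z, Continuous fun g => p g z) (w : (J × J) ⊕ Fin k →₀ ℝ) :
    Continuous fun g => flowCost α (edgeLen (p g)) w := by
  simp only [flowCost_edgeLen]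
  exact continuous_finsetSum _ fun e _ => continuous_const.mul ((hp _).dist (hp _))

/-- Among the placements of the free vertices of networks of bounded size, one is best. -/
lemma exists_min_placement {J Y : Type*} [Finite J] [TopologicalSpace Y] {A : Set Y}
    (hA : IsCompact A) (hA0 : A.Nonempty) {p : Y → J → Pt m}
    (hp : ∀ z, Continuous fun g => p g z) (xJ : Fin k → J) (c : J →₀ ℝ)
    (hF : ∃ w, (∀ e, 0 ≤ w e) ∧ bdry xJ w = c ∧ IsBasic (bdry xJ) w) :
    ∃ w, ((∀ e, 0 ≤ w e) ∧ bdry xJ w = c ∧ IsBasic (bdry xJ) w) ∧ ∃ g ∈ A,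
      ∀ w', (∀ e, 0 ≤ w' e) → bdry xJ w' = c → IsBasic (bdry xJ) w' → ∀ g' ∈ A,
        flowCost α (edgeLen (p g)) w ≤ flowCost α (edgeLen (p g')) w' := by
  have hmin : ∀ w : (J × J) ⊕ Fin k →₀ ℝ, ∃ g ∈ A, ∀ g' ∈ A,
      flowCost α (edgeLen (p g)) w ≤ flowCost α (edgeLen (p g')) w := fun w =>
    hA.exists_isMinOn hA0 (continuous_flowCost_edgeLen hp w).continuousOn
  choose g hgA hg using hmin
  have hfin : {w | (∀ e, 0 ≤ w e) ∧ bdry xJ w = c ∧ IsBasic (bdry xJ) w}.Finite :=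
    (finite_isBasic (bdry xJ) c).subset fun w hw => hw.2
  obtain ⟨w, hw, hwmin⟩ := Set.exists_min_image _
    (fun w => flowCost α (edgeLen (p (g w))) w) hfin hF
  exact ⟨w, hw, g w, hgA w, fun w' h1 h2 h3 g' hg' =>
    (hwmin w' ⟨h1, h2, h3⟩).trans (hg w' g' hg')⟩

lemma mapDomain_neg {J K : Type*} (φ : J → K) (c : J →₀ ℝ) :
    Finsupp.mapDomain φ (-c) = -Finsupp.mapDomain φ c :=
  map_neg (Finsupp.mapDomain.addMonoidHom φ) c

/-- The placement of the vertices of an abstract network with terminals `T`. -/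
def place (T : Finset (Pt m)) {N : ℕ} (g : Fin N → Pt m) : T ⊕ Fin N → Pt m :=
  Sum.elim Subtype.val g

/-- The demand `b` seen at the terminals of an abstract network. -/
def abstractDemand (T : Finset (Pt m)) (N : ℕ) (b : Pt m →₀ ℝ) : T ⊕ Fin N →₀ ℝ :=
  ∑ z : T, Finsupp.single (Sum.inl z) (b z)

lemma mapDomain_place_abstractDemand {T : Finset (Pt m)} {N : ℕ} (g : Fin N → Pt m)
    {b : Pt m →₀ ℝ} (hbT : b.support ⊆ T) :
    Finsupp.mapDomain (place T g) (abstractDemand T N b) = b := by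
  rw [abstractDemand, Finsupp.mapDomain_finsetSum]
  simp only [Finsupp.mapDomain_single, place, Sum.elim_inl]
  rw [Finset.sum_coe_sort T fun z => Finsupp.single z (b z)]
  conv_rhs => rw [← Finsupp.sum_single b]
  exact (Finset.sum_subset hbT fun z _ hz => by
    rw [Finsupp.notMem_support_iff.mp hz, Finsupp.single_zero]).symm

lemma mapDomain_eq_abstractDemand {T : Finset (Pt m)} {N : ℕ} {b : Pt m →₀ ℝ}
    (hbT : b.support ⊆ T) {q : Pt m → T ⊕ Fin N} (hq : ∀ z : T, q z = Sum.inl z) :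
    Finsupp.mapDomain q b = abstractDemand T N b := by
  rw [abstractDemand]
  simp only [← hq]
  rw [Finset.sum_coe_sort T fun z => Finsupp.single (q z) (b z), Finsupp.mapDomain, Finsupp.sum]
  exact Finset.sum_subset hbT fun z _ hz => by
    rw [Finsupp.notMem_support_iff.mp hz, Finsupp.single_zero]

/-- A flow with few vertices comes from an abstract network of bounded size. -/
lemma IsFlow.exists_abstract (hα0 : 0 ≤ α) (hα1 : α ≤ 1) {X : Set (Pt m)} {x : Fin k → Pt m}
    {b : Pt m →₀ ℝ} {T : Finset (Pt m)} (hxT : ∀ i, x i ∈ T) (hbT : b.support ⊆ T) {N : ℕ}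
    {u : (Pt m × Pt m) ⊕ Fin k →₀ ℝ} (hu : IsFlow X x b u)
    (hN : (flowVerts u \ T).card < N) (hX : X.Nonempty) :
    ∃ w : ((T ⊕ Fin N) × (T ⊕ Fin N)) ⊕ Fin k →₀ ℝ, ((∀ e, 0 ≤ w e) ∧
      bdry (fun i => Sum.inl ⟨x i, hxT i⟩) w = -abstractDemand T N b ∧
      IsBasic (bdry fun i => Sum.inl ⟨x i, hxT i⟩) w) ∧
      ∃ g : Fin N → Pt m, (∀ r, g r ∈ X) ∧
        flowCost α (edgeLen (place T g)) w ≤ flowCost α (edgeLen id) u := by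
  obtain ⟨x₀, hx₀⟩ := hX
  obtain ⟨f⟩ : Nonempty ((flowVerts u \ T : Finset (Pt m)) ↪ Fin N) :=
    Function.Embedding.nonempty_of_card_le (by simpa using hN.le)
  have hvX : ∀ z ∈ flowVerts u, z ∈ X := by
    intro z hz
    rcases Finset.mem_union.mp hz with h | h
    · obtain ⟨⟨p, q⟩, he, rfl⟩ := Finset.mem_image.mp h
      exact (hu.mem p q (Finset.mem_toLeft.mp he)).1
    · obtain ⟨⟨p, q⟩, he, rfl⟩ := Finset.mem_image.mp h
      exact (hu.mem p q (Finset.mem_toLeft.mp he)).2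
  let g : Fin N → Pt m := Function.extend f Subtype.val fun _ => x₀
  let q : Pt m → T ⊕ Fin N := fun z =>
    if hz : z ∈ T then Sum.inl ⟨z, hz⟩ else
      if hz : z ∈ flowVerts u \ T then Sum.inr (f ⟨z, hz⟩) else Sum.inr ⟨0, by omega⟩
  have hqT : ∀ z : T, q z = Sum.inl z := fun z => dif_pos z.2
  have hgq : ∀ z ∈ flowVerts u, place T g (q z) = z := by
    intro z hz
    by_cases hzT : z ∈ T
    · rw [hqT ⟨z, hzT⟩]
      rfl
    · have hz' := Finset.mem_sdiff.mpr ⟨hz, hzT⟩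
      have h : q z = Sum.inr (f ⟨z, hz'⟩) := by
        simp only [q, dif_neg hzT, dif_pos hz']
      rw [h]
      exact f.injective.extend_apply Subtype.val (fun _ => x₀) ⟨z, hz'⟩
  have hgX : ∀ r, g r ∈ X := by
    intro r
    by_cases hr : ∃ z, f z = r
    · obtain ⟨z, rfl⟩ := hr
      simp only [g, f.injective.extend_apply]
      exact hvX _ (Finset.mem_sdiff.mp z.2).1
    · simp only [g, Function.extend_apply' _ _ _ hr]
      exact hx₀
  have hbd : bdry (fun i => Sum.inl ⟨x i, hxT i⟩) (Finsupp.mapDomain (edgeMap q) u) =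
      -abstractDemand T N b := by
    have h := bdry_mapDomain x q u
    rw [hu.bdry_eq, mapDomain_neg, mapDomain_eq_abstractDemand hbT hqT] at h
    rw [← h]
    congr 2
    exact funext fun i => (hqT ⟨x i, hxT i⟩).symm
  obtain ⟨w, hw0, -, hwD, hwc, hwb⟩ := _root_.exists_isBasic hα0 hα1 (edgeLen_nonneg (place T g))
    (bdry fun i => Sum.inl ⟨x i, hxT i⟩) (Finsupp.mapDomain (edgeMap q) u)
    (mapDomain_nonneg_of_nonneg _ hu.nonneg)
  refine ⟨w, ⟨hw0, hwD.trans hbd, hwb⟩, g, hgX, hwc.trans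
    ((flowCost_mapDomain_le hα0 hα1 _ (edgeLen_nonneg _) hu.nonneg).trans ?_)⟩
  rw [edgeLen_comp_edgeMap]
  refine (flowCost_congr ?_).le
  rintro (e | i) he
  · simp only [edgeLen, Function.comp_apply, id_eq]
    rw [hgq _ (fst_mem_flowVerts (Finset.mem_toLeft.mpr he)),
      hgq _ (snd_mem_flowVerts (Finset.mem_toLeft.mpr he))]
  · rfl

/-- Some flow has minimal cost. -/
lemma exists_isFlow_min (hα0 : 0 ≤ α) (hα1 : α ≤ 1) {X : Set (Pt m)} (hXc : IsCompact X)
    {x : Fin k → Pt m} (hxX : ∀ i, x i ∈ X) {b : Pt m →₀ ℝ} (hbX : ↑b.support ⊆ X)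
    (hX : X.Nonempty) (hne : ∃ u, IsFlow X x b u) :
    ∃ u, IsFlow X x b u ∧ IsBasic (bdry x) u ∧
      ∀ u', IsFlow X x b u' → flowCost α (edgeLen id) u ≤ flowCost α (edgeLen id) u' := by
  set T : Finset (Pt m) := Finset.univ.image x ∪ b.support with hT
  have hxT : ∀ i, x i ∈ T := fun i =>
    Finset.mem_union_left _ (Finset.mem_image_of_mem _ (Finset.mem_univ i))
  have hbT : b.support ⊆ T := Finset.subset_union_right
  have hTX : ∀ z ∈ T, z ∈ X := by
    intro z hz
    rcases Finset.mem_union.mp hz with h | h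
    · obtain ⟨i, -, rfl⟩ := Finset.mem_image.mp h
      exact hxX i
    · exact hbX h
  have key : ∀ u, IsFlow X x b u → ∃ w, ((∀ e, 0 ≤ w e) ∧
      bdry (fun i => Sum.inl ⟨x i, hxT i⟩) w = -abstractDemand T (2 * T.card + 1) b ∧
      IsBasic (bdry fun i => Sum.inl ⟨x i, hxT i⟩) w) ∧
      ∃ g : Fin (2 * T.card + 1) → Pt m, (∀ r, g r ∈ X) ∧
        flowCost α (edgeLen (place T g)) w ≤ flowCost α (edgeLen id) u := by
    intro u hu
    obtain ⟨u', hu', hc, hcard⟩ := IsFlow.exists_card_verts_le hα0 hα1 hxT hbT u hu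
    obtain ⟨w, hw, g, hg, hwc⟩ :=
      hu'.exists_abstract hα0 hα1 hxT hbT (Nat.lt_succ_of_le hcard) hX
    exact ⟨w, hw, g, hg, hwc.trans hc⟩
  obtain ⟨w, ⟨hw0, hwD, -⟩, g, hg, hmin⟩ := exists_min_placement (α := α)
    (isCompact_univ_pi fun _ : Fin (2 * T.card + 1) => hXc)
    (Set.univ_pi_nonempty_iff.mpr fun _ => hX) (p := place T) (by
      rintro (z | r)
      · exact continuous_const
      · exact continuous_apply r) _ _
    (hne.elim fun u hu => (key u hu).imp fun w hw => hw.1)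
  have hpX : ∀ z, place T g z ∈ X := by
    rintro (z | r)
    · exact hTX z z.2
    · exact hg r (Set.mem_univ r)
  have hflow : IsFlow X x b (Finsupp.mapDomain (edgeMap (place T g)) w) := by
    refine ⟨mapDomain_nonneg_of_nonneg _ hw0, fun p q h => ?_, ?_⟩
    · obtain ⟨e, -, h⟩ := Finset.mem_image.mp (Finsupp.mapDomain_support h)
      rcases e with ⟨p', q'⟩ | i
      · obtain ⟨rfl, rfl⟩ := Prod.mk.inj (Sum.inl_injective h)
        exact ⟨hpX _, hpX _⟩
      · exact absurd h (by simp [edgeMap])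
    · have h := bdry_mapDomain (fun i => Sum.inl ⟨x i, hxT i⟩) (place T g) w
      rw [hwD, mapDomain_neg, mapDomain_place_abstractDemand g hbT] at h
      exact h
  obtain ⟨u, hu, -, huc, hub⟩ := hflow.exists_isBasic (α := α) hα0 hα1
  refine ⟨u, hu, hub, fun u' hu' => huc.trans
    ((flowCost_mapDomain_le hα0 hα1 _ (edgeLen_nonneg _) hw0).trans ?_)⟩
  obtain ⟨w', ⟨h0, hD, hb⟩, g', hg', hc⟩ := key u' hu'
  rw [edgeLen_comp_edgeMap, Function.id_comp]
  exact (hmin w' h0 hD hb g' fun r _ => hg' r).trans hc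

end Existence

/-- The minimum of `E_α` over assignment maps equals the minimum
of `M_α` over allocation paths: both minima are attained, and any optimal
assignment map and any optimal allocation path have equal values. -/
theorem stmt_7 {m k ℓ : ℕ} (X : Set (Pt m)) (hXc : IsCompact X) (hXconv : Convex ℝ X)
    (α : ℝ) (hα0 : 0 ≤ α) (hα1 : α < 1)
    (x : Fin k → Pt m) (hxinj : Function.Injective x) (hxX : ∀ i, x i ∈ X)
    (y : Fin ℓ → Pt m) (hyinj : Function.Injective y) (hyX : ∀ j, y j ∈ X)
    (n : Fin ℓ → ℝ) (hn : ∀ j, 0 < n j) (hnsum : ∑ j, n j = 1)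
    (hk : 0 < k) :
    (∃ S : Fin ℓ → Fin k, IsOptimalAssign X α x y n S) ∧
    (∃ G : WDG m, IsOptimalAllocPath X α x y n G) ∧
    ∀ (S : Fin ℓ → Fin k) (G : WDG m), IsOptimalAssign X α x y n S →
      IsOptimalAllocPath X α x y n G → Ealpha X α x y n S = WDG.cost α G := by
  have hbX : ↑(bMeas y n).support ⊆ X :=
    (support_sum_single_subset _ _ _).trans (Set.range_subset_iff.mpr hyX)
  obtain ⟨u₀, hu₀, -⟩ :=
    exists_isFlow_star hxX hyX (fun j => (hn j).le) Finset.univ (⟨0, hk⟩ : Fin k)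
  obtain ⟨u, hu, hub, hmin⟩ := exists_isFlow_min (b := bMeas y n) hα0 hα1.le hXc hxX hbX
    ⟨_, hxX ⟨0, hk⟩⟩ ⟨u₀, hu₀⟩
  obtain ⟨S₀, hS₀⟩ := hu.exists_assignment (α := α) hxX hyX hn hub
  obtain ⟨G₀, hG₀, hG₀c⟩ := hu.exists_isAllocPath (α := α) hxX hyX hnsum hub
  have hS := le_Ealpha hα0 hα1.le hxX hyX (fun j => (hn j).le) hk hmin
  have hG : ∀ G, IsAllocPath X x y n G → flowCost α (edgeLen id) u ≤ WDG.cost α G :=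
    fun G => IsAllocPath.le_cost hα0 hα1.le hxinj hmin
  refine ⟨⟨S₀, fun S => hS₀.trans (hS S)⟩, ⟨G₀, hG₀, fun G h => hG₀c.trans_le (hG G h)⟩,
    fun S G hSopt hGopt => le_antisymm ?_ ?_⟩
  · exact (hSopt S₀).trans (hS₀.trans (hG G hGopt.1))
  · exact (hGopt.2 G₀ hG₀).trans (hG₀c.trans_le (hS S))

end
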